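/- Let ℓ ≥ 1 be an integer. Let ε_n ≥ 0 with n·ε_n bounded (ε_n ≪ 1/n), and let angles satisfy 0 ≤ φ_n^(1) < φ_n^(2) < … < φ_n^(ℓ) < 2π − δ₀ for some δ₀ > 0 and all n. Suppose that for all i ≠ j, −log|φ_n^(j) − φ_n^(i)| / log n converges as n → ∞ to some c_{i,j} ∈ [0,∞]. Let u_n be distributed according to Haar probability measure on the unitary group U(n). Then the random vector ( (log n)^{−1/2} · log Z(u_n, e^{ε_n + i φ_n^(k)}) )_{1≤k≤ℓ} converges in distribution, as n → ∞, to a centered complex Gaussian vector (Y₁,…,Y_ℓ) with cov(Y_i,Y_j) = 1 if i = j and cov(Y_i,Y_j) = min(c_{i,j}, 1) if i ≠ j. -/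

import Mathlib

open MeasureTheory Filter
open scoped ENNReal Topology ComplexConjugate

attribute [local instance] Classical.propDecidable

noncomputable instance (n : ℕ) : MeasurableSpace (Matrix (Fin n) (Fin n) ℂ) := borel _

/-- The series `-∑_{j≥1} Tr(u^j) e^{-j(ε+iφ)} / j` (absolutely convergent for `ε > 0`). -/
noncomputable def logZser (n : ℕ) (u : Matrix.unitaryGroup (Fin n) ℂ) (ε φ : ℝ) : ℂ :=
  -∑' j : ℕ, Matrix.trace ((u : Matrix (Fin n) (Fin n) ℂ) ^ (j + 1)) *
      Complex.exp (-((j : ℂ) + 1) * (ε + φ * Complex.I)) / ((j : ℂ) + 1)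

/-- `log Z(u, e^{ε+iφ})`: for `ε > 0` the absolutely convergent series
`-∑_{j≥1} Tr(u^j) e^{-j(ε+iφ)}/j`; for `ε = 0` the radial limit from `ε > 0`
(which agrees a.e. with the `L²` limit of the series). -/
noncomputable def logZ (n : ℕ) (u : Matrix.unitaryGroup (Fin n) ℂ) (ε φ : ℝ) : ℂ :=
  if 0 < ε then logZser n u ε φ
  else limUnder (nhdsWithin (0 : ℝ) (Set.Ioi 0)) (fun ε' => logZser n u ε' φ)

/-- The law of a standard complex normal variable. -/
noncomputable def stdComplexNormal : Measure ℂ :=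
  ((ProbabilityTheory.gaussianReal 0 (1/2)).prod (ProbabilityTheory.gaussianReal 0 (1/2))).map
    (fun p => (p.1 : ℂ) + p.2 * Complex.I)

/-- The law of a centered complex normal variable with variance `v`. -/
noncomputable def complexNormal (v : ℝ) : Measure ℂ :=
  stdComplexNormal.map (fun z => (Real.sqrt v : ℂ) * z)

/-- `γ` is the law of a centered complex Gaussian vector with covariance matrix `C`. -/
def IsCenteredComplexGaussianVector {ℓ : ℕ} (γ : Measure (Fin ℓ → ℂ))
    (C : Fin ℓ → Fin ℓ → ℂ) : Prop :=
  IsProbabilityMeasure γ ∧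
  ∀ μ : Fin ℓ → ℂ, γ.map (fun z => ∑ i, μ i * z i)
      = complexNormal (∑ i, ∑ j, conj (μ i) * C i j * μ j).re

section UnitaryBasics

/-- The group of `n × n` unitary matrices, as a type. -/
abbrev UnitaryMat (n : ℕ) : Type := Matrix.unitaryGroup (Fin n) ℂ

variable {n : ℕ}

instance : BorelSpace (Matrix (Fin n) (Fin n) ℂ) := ⟨rfl⟩

instance : CompactSpace (UnitaryMat n) := by
  have hsub : (Matrix.unitaryGroup (Fin n) ℂ : Set (Matrix (Fin n) (Fin n) ℂ)) ⊆
      Set.pi Set.univ fun _ => Set.pi Set.univ fun _ => Metric.closedBall (0 : ℂ) 1 := by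
    intro U hU i _ j _
    simpa using entry_norm_bound_of_unitary hU i j
  have hcpt : IsCompact (Set.pi Set.univ fun _ : Fin n => Set.pi Set.univ fun _ : Fin n =>
      Metric.closedBall (0 : ℂ) 1) :=
    isCompact_univ_pi fun _ => isCompact_univ_pi fun _ => isCompact_closedBall 0 1
  have hclosed : IsClosed (Matrix.unitaryGroup (Fin n) ℂ : Set (Matrix (Fin n) (Fin n) ℂ)) := by
    have : (Matrix.unitaryGroup (Fin n) ℂ : Set (Matrix (Fin n) (Fin n) ℂ)) =
        {U | U * star U = 1} := by
      ext U
      exact Matrix.mem_unitaryGroup_iff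
    rw [this]
    exact isClosed_eq (by fun_prop) continuous_const
  exact isCompact_iff_compactSpace.mp (hcpt.of_isClosed_subset hclosed hsub)

lemma integrable_of_continuous {μ : Measure (UnitaryMat n)} [IsFiniteMeasure μ]
    {f : UnitaryMat n → ℂ} (hf : Continuous f) : Integrable f μ :=
  hf.integrable_of_hasCompactSupport (HasCompactSupport.of_compactSpace f)

/-- The power traces `Tr (u ^ j)`, `j ∈ ℤ`. -/
noncomputable def powTr (u : UnitaryMat n) (j : ℤ) : ℂ :=
  Matrix.trace ((u ^ j : UnitaryMat n) : Matrix (Fin n) (Fin n) ℂ)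

lemma continuous_zpow_val (j : ℤ) :
    Continuous fun u : UnitaryMat n => ((u ^ j : UnitaryMat n) : Matrix (Fin n) (Fin n) ℂ) :=
  continuous_subtype_val.comp (continuous_zpow j)

@[fun_prop]
lemma continuous_powTr (j : ℤ) : Continuous fun u : UnitaryMat n => powTr u j :=
  (continuous_zpow_val j).matrix_trace

lemma powTr_zero (u : UnitaryMat n) : powTr u 0 = n := by
  simp [powTr]

lemma powTr_natCast (u : UnitaryMat n) (k : ℕ) :
    powTr u k = Matrix.trace ((u : Matrix (Fin n) (Fin n) ℂ) ^ k) := by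
  simp [powTr]

lemma zpow_neg_val (u : UnitaryMat n) (j : ℤ) :
    ((u ^ (-j) : UnitaryMat n) : Matrix (Fin n) (Fin n) ℂ) =
      star ((u ^ j : UnitaryMat n) : Matrix (Fin n) (Fin n) ℂ) := by
  rw [zpow_neg]
  rfl

lemma powTr_neg (u : UnitaryMat n) (j : ℤ) : powTr u (-j) = conj (powTr u j) := by
  rw [powTr, zpow_neg_val, Matrix.star_eq_conjTranspose, Matrix.trace_conjTranspose]
  rfl

lemma norm_powTr_le (u : UnitaryMat n) (j : ℤ) : ‖powTr u j‖ ≤ n := by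
  refine (norm_sum_le Finset.univ fun i =>
    ((u ^ j : UnitaryMat n) : Matrix (Fin n) (Fin n) ℂ) i i).trans ?_
  calc ∑ i, ‖((u ^ j : UnitaryMat n) : Matrix (Fin n) (Fin n) ℂ) i i‖ ≤ ∑ _i : Fin n, (1 : ℝ) :=
        Finset.sum_le_sum fun i _ => entry_norm_bound_of_unitary (u ^ j).2 i i
    _ = n := by simp

end UnitaryBasics

section IntegrationByParts

variable {n : ℕ}

lemma exp_smul_mem_unitary {X : Matrix (Fin n) (Fin n) ℂ} (hX : star X = -X) (t : ℝ) :
    NormedSpace.exp (t • X) ∈ Matrix.unitaryGroup (Fin n) ℂ := by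
  rw [Matrix.mem_unitaryGroup_iff, Matrix.star_eq_conjTranspose, ← Matrix.exp_conjTranspose,
    Matrix.conjTranspose_smul, ← Matrix.star_eq_conjTranspose, hX, star_trivial, smul_neg,
    Matrix.exp_neg]
  exact Matrix.mul_nonsing_inv _ (Matrix.isUnit_iff_isUnit_det _ |>.mp (Matrix.isUnit_exp _))

/-- The one-parameter subgroup of the unitary group generated by a skew-adjoint matrix. -/
noncomputable def expUnitaryMat {X : Matrix (Fin n) (Fin n) ℂ} (hX : star X = -X) (t : ℝ) :
    UnitaryMat n :=
  ⟨NormedSpace.exp (t • X), exp_smul_mem_unitary hX t⟩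

variable {X : Matrix (Fin n) (Fin n) ℂ} (hX : star X = -X)

lemma expUnitaryMat_zero : expUnitaryMat hX 0 = 1 := by
  ext1
  simp [expUnitaryMat]

lemma expUnitaryMat_add (s t : ℝ) :
    expUnitaryMat hX (s + t) = expUnitaryMat hX s * expUnitaryMat hX t := by
  apply Subtype.ext
  simp only [expUnitaryMat, add_smul, Submonoid.coe_mul]
  exact Matrix.exp_add_of_commute _ _ (((Commute.refl X).smul_left s).smul_right t)

section

attribute [local instance] Matrix.linftyOpNormedRing Matrix.linftyOpNormedAlgebra

lemma hasDerivAt_exp_smul_apply (X : Matrix (Fin n) (Fin n) ℂ) (a b : Fin n) :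
    HasDerivAt (fun t : ℝ => NormedSpace.exp (t • X) a b) (X a b) 0 := by
  have h := hasDerivAt_exp_smul_const (𝕂 := ℝ) X 0
  rw [zero_smul, NormedSpace.exp_zero, one_mul] at h
  let l : Matrix (Fin n) (Fin n) ℂ →L[ℝ] ℂ :=
    LinearMap.toContinuousLinearMap (Matrix.entryLinearMap ℝ ℂ a b)
  exact l.hasFDerivAt.comp_hasDerivAt (0 : ℝ) h

end

/-- Entrywise differentiability at `0` of a matrix-valued function. -/
def HasEntryDeriv (f : ℝ → Matrix (Fin n) (Fin n) ℂ) (f' : Matrix (Fin n) (Fin n) ℂ) : Prop :=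
  ∀ a b, HasDerivAt (fun t => f t a b) (f' a b) 0

lemma HasEntryDeriv.mul {f g : ℝ → Matrix (Fin n) (Fin n) ℂ} {f' g' : Matrix (Fin n) (Fin n) ℂ}
    (hf : HasEntryDeriv f f') (hg : HasEntryDeriv g g') :
    HasEntryDeriv (fun t => f t * g t) (f' * g 0 + f 0 * g') := by
  intro a b
  simp only [Matrix.add_apply, Matrix.mul_apply, ← Finset.sum_add_distrib]
  exact HasDerivAt.fun_sum fun c _ => (hf a c).mul (hg c b)

lemma HasEntryDeriv.trace {f : ℝ → Matrix (Fin n) (Fin n) ℂ} {f' : Matrix (Fin n) (Fin n) ℂ}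
    (hf : HasEntryDeriv f f') : HasDerivAt (fun t => (f t).trace) f'.trace 0 :=
  HasDerivAt.fun_sum fun a _ => hf a a

lemma hasEntryDeriv_const (A : Matrix (Fin n) (Fin n) ℂ) :
    HasEntryDeriv (fun _ => A) 0 := fun _ _ => hasDerivAt_const _ _

lemma hasEntryDeriv_expUnitaryMat_mul (u : UnitaryMat n) :
    HasEntryDeriv
      (fun t => ((expUnitaryMat hX t * u : UnitaryMat n) : Matrix (Fin n) (Fin n) ℂ))
      (X * (u : Matrix (Fin n) (Fin n) ℂ)) := by
  have h : HasEntryDeriv (fun t => NormedSpace.exp (t • X)) X := hasDerivAt_exp_smul_apply X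
  simpa [expUnitaryMat] using h.mul (hasEntryDeriv_const (u : Matrix (Fin n) (Fin n) ℂ))

/-- A left-invariant probability measure kills infinitesimal left translations. -/
lemma integral_deriv_eq_zero {μ : Measure (UnitaryMat n)} [IsProbabilityMeasure μ]
    [μ.IsMulLeftInvariant]
    {f f' : UnitaryMat n → ℂ} (hf : Continuous f) (hf' : Continuous f')
    (hderiv : ∀ u, HasDerivAt (fun t : ℝ => f (expUnitaryMat hX t * u)) (f' u) 0) :
    ∫ u, f' u ∂μ = 0 := by
  obtain ⟨C, hC⟩ := (isCompact_range hf').isBounded.exists_norm_le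
  have hshift : ∀ (u : UnitaryMat n) (t : ℝ),
      HasDerivAt (fun t : ℝ => f (expUnitaryMat hX t * u)) (f' (expUnitaryMat hX t * u)) t := by
    intro u t
    have h1 := hderiv (expUnitaryMat hX t * u)
    have h2 : HasDerivAt (fun s : ℝ => s - t) 1 t := (hasDerivAt_id t).sub_const t
    have h3 := HasDerivAt.scomp t (h := fun s : ℝ => s - t) (by simpa using h1) h2
    simp only [one_smul] at h3
    refine h3.congr_of_eventuallyEq (Eventually.of_forall fun s => ?_)
    simp only [Function.comp]
    rw [← mul_assoc, ← expUnitaryMat_add, sub_add_cancel]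
  have hmain := hasDerivAt_integral_of_dominated_loc_of_deriv_le (μ := μ) (𝕜 := ℝ)
    (F := fun t u => f (expUnitaryMat hX t * u)) (F' := fun t u => f' (expUnitaryMat hX t * u))
    (bound := fun _ => C) (x₀ := 0) Filter.univ_mem
    (Eventually.of_forall fun t =>
      (integrable_of_continuous (by fun_prop)).aestronglyMeasurable)
    (integrable_of_continuous (by fun_prop))
    ((integrable_of_continuous (by fun_prop)).aestronglyMeasurable)
    (Eventually.of_forall fun u t _ => hC _ ⟨_, rfl⟩)
    (integrable_const _)
    (Eventually.of_forall fun u t _ => hshift u t)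
  have hconst : (fun t : ℝ => ∫ u, f (expUnitaryMat hX t * u) ∂μ) = fun _ => ∫ u, f u ∂μ := by
    funext t
    exact integral_mul_left_eq_self f _
  have h0 := hmain.2
  rw [hconst] at h0
  have := h0.unique (hasDerivAt_const _ _)
  simpa [expUnitaryMat_zero] using this

lemma hasEntryDeriv_pow_expUnitaryMat_mul (u : UnitaryMat n) (k : ℕ) :
    HasEntryDeriv (fun t : ℝ =>
        ((expUnitaryMat hX t * u : UnitaryMat n) : Matrix (Fin n) (Fin n) ℂ) ^ k)
      (∑ i ∈ Finset.range k, (u : Matrix (Fin n) (Fin n) ℂ) ^ i * X *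
        (u : Matrix (Fin n) (Fin n) ℂ) ^ (k - i)) := by
  have h := hasEntryDeriv_expUnitaryMat_mul hX u
  induction k with
  | zero => simpa using hasEntryDeriv_const (1 : Matrix (Fin n) (Fin n) ℂ)
  | succ k ih =>
    have h2 := ih.mul h
    simp only [expUnitaryMat_zero, one_mul] at h2
    simp only [pow_succ _ k]
    convert h2 using 1
    rw [Finset.sum_range_succ, Finset.sum_mul]
    congr 1
    · refine Finset.sum_congr rfl fun i hi => ?_
      rw [mul_assoc _ _ (u : Matrix (Fin n) (Fin n) ℂ), ← pow_succ,
        Nat.sub_add_comm (Finset.mem_range.mp hi).le]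
    · simp [mul_assoc]

lemma hasDerivAt_powTr_natCast (u : UnitaryMat n) (k : ℕ) :
    HasDerivAt (fun t : ℝ => powTr (expUnitaryMat hX t * u) k)
      (k * Matrix.trace (X * ((u ^ (k : ℤ) : UnitaryMat n) : Matrix (Fin n) (Fin n) ℂ))) 0 := by
  have h := (hasEntryDeriv_pow_expUnitaryMat_mul hX u k).trace
  simp only [powTr_natCast]
  convert h using 1
  rw [Matrix.trace_sum]
  have : ∀ i ∈ Finset.range k, Matrix.trace ((u : Matrix (Fin n) (Fin n) ℂ) ^ i * X *
      (u : Matrix (Fin n) (Fin n) ℂ) ^ (k - i)) =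
      Matrix.trace (X * ((u ^ (k : ℤ) : UnitaryMat n) : Matrix (Fin n) (Fin n) ℂ)) := by
    intro i hi
    rw [Matrix.trace_mul_cycle, ← pow_add,
      Nat.sub_add_cancel (Finset.mem_range.mp hi).le, Matrix.trace_mul_comm]
    simp
  rw [Finset.sum_congr rfl this]
  simp

lemma hasDerivAt_powTr (u : UnitaryMat n) (j : ℤ) :
    HasDerivAt (fun t : ℝ => powTr (expUnitaryMat hX t * u) j)
      (j * Matrix.trace (X * ((u ^ j : UnitaryMat n) : Matrix (Fin n) (Fin n) ℂ))) 0 := by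
  obtain ⟨k, rfl | rfl⟩ := j.eq_nat_or_neg
  · simpa using hasDerivAt_powTr_natCast hX u k
  · have h := (hasDerivAt_powTr_natCast hX u k).star
    simp only [powTr_neg]
    refine h.congr_deriv ?_
    rw [zpow_neg_val, star_mul', ← Matrix.trace_conjTranspose, Matrix.conjTranspose_mul,
      ← Matrix.star_eq_conjTranspose, ← Matrix.star_eq_conjTranspose, hX, Matrix.trace_mul_comm]
    simp

end IntegrationByParts

section LoopEquation

open MvPolynomial

variable {n : ℕ}

lemma derivation_eq_sum_vars (D : Derivation ℂ (MvPolynomial ℤ ℂ) (MvPolynomial ℤ ℂ))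
    (F : MvPolynomial ℤ ℂ) : D F = ∑ j ∈ F.vars, D (X j) * pderiv j F := by
  have h := derivation_eq_of_forall_mem_vars (D₁ := D)
    (D₂ := ∑ j ∈ F.vars, D (X j) • pderiv (R := ℂ) j) (f := F) ?_
  · rw [h]
    simp only [← Derivation.coeFnAddMonoidHom_apply, map_sum, Finset.sum_apply]
    simp
  · intro i hi
    simp only [← Derivation.coeFnAddMonoidHom_apply, map_sum, Finset.sum_apply]
    simp [pderiv_X, Pi.single_apply, Finset.sum_ite_eq, hi]

/-- Evaluation of a polynomial in the power traces. -/
noncomputable def traceEval (u : UnitaryMat n) : MvPolynomial ℤ ℂ →ₐ[ℂ] ℂ := aeval (powTr u)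

@[simp]
lemma traceEval_X (u : UnitaryMat n) (j : ℤ) : traceEval u (X j) = powTr u j := by
  simp [traceEval]

@[simp]
lemma traceEval_C (u : UnitaryMat n) (a : ℂ) : traceEval u (C a) = a := by
  simp [traceEval]

@[fun_prop]
lemma continuous_traceEval (F : MvPolynomial ℤ ℂ) :
    Continuous fun u : UnitaryMat n => traceEval u F := by
  induction F using MvPolynomial.induction_on with
  | C a => simpa using continuous_const
  | add p q hp hq =>
    simp only [map_add]
    exact hp.add hq
  | mul_X p j hp =>
    simp only [map_mul, traceEval_X]
    exact hp.mul (continuous_powTr j)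

lemma hasDerivAt_traceEval {A : Matrix (Fin n) (Fin n) ℂ} (hA : star A = -A) (u : UnitaryMat n)
    (F : MvPolynomial ℤ ℂ) :
    HasDerivAt (fun t : ℝ => traceEval (expUnitaryMat hA t * u) F)
      (∑ j ∈ F.vars, j * Matrix.trace (A * ((u ^ j : UnitaryMat n) : Matrix (Fin n) (Fin n) ℂ)) *
        traceEval u (pderiv j F)) 0 := by
  set D : Derivation ℂ (MvPolynomial ℤ ℂ) (MvPolynomial ℤ ℂ) := mkDerivation ℂ (fun j : ℤ =>
        (C (j * Matrix.trace (A * ((u ^ j : UnitaryMat n) : Matrix (Fin n) (Fin n) ℂ))) :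
          MvPolynomial ℤ ℂ)) with hD
  have hDF : ∑ j ∈ F.vars, j * Matrix.trace (A * ((u ^ j : UnitaryMat n) :
      Matrix (Fin n) (Fin n) ℂ)) * traceEval u (pderiv j F) = traceEval u (D F) := by
    rw [derivation_eq_sum_vars D F, map_sum]
    refine Finset.sum_congr rfl fun j _ => ?_
    rw [map_mul, hD, mkDerivation_X, traceEval_C]
  rw [hDF]
  clear hDF
  induction F using MvPolynomial.induction_on with
  | C a => simpa using hasDerivAt_const (0 : ℝ) a
  | add p q hp hq =>
    simp only [map_add]
    exact hp.fun_add hq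
  | mul_X p j hp =>
    have h := hp.fun_mul (hasDerivAt_powTr hA u j)
    have hDX : traceEval u (D (X j)) =
        j * Matrix.trace (A * ((u ^ j : UnitaryMat n) : Matrix (Fin n) (Fin n) ℂ)) := by
      rw [hD, mkDerivation_X, traceEval_C]
    simp only [map_mul, traceEval_X, Derivation.leibniz, smul_eq_mul, map_add, hDX]
    refine h.congr_deriv ?_
    simp only [expUnitaryMat_zero, one_mul]
    ring

/-- The derivation `X_j ↦ j X_{k+j}`. -/
noncomputable def shiftDerivation (k : ℤ) :
    Derivation ℂ (MvPolynomial ℤ ℂ) (MvPolynomial ℤ ℂ) :=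
  mkDerivation ℂ fun j : ℤ => C (j : ℂ) * X (k + j)

/-- The infinitesimal variation of `(u ^ k) a b * F` in the direction `A`. -/
noncomputable def entryVariation (k : ℕ) (F : MvPolynomial ℤ ℂ) (a b : Fin n)
    (A : Matrix (Fin n) (Fin n) ℂ) (u : UnitaryMat n) : ℂ :=
  (∑ i ∈ Finset.range k, (u : Matrix (Fin n) (Fin n) ℂ) ^ i * A *
        (u : Matrix (Fin n) (Fin n) ℂ) ^ (k - i)) a b * traceEval u F +
    ((u : Matrix (Fin n) (Fin n) ℂ) ^ k) a b *
      ∑ j ∈ F.vars, j * Matrix.trace (A * ((u ^ j : UnitaryMat n) : Matrix (Fin n) (Fin n) ℂ)) *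
        traceEval u (pderiv j F)

lemma continuous_entryVariation (k : ℕ) (F : MvPolynomial ℤ ℂ) (a b : Fin n)
    (A : Matrix (Fin n) (Fin n) ℂ) : Continuous (entryVariation k F a b A) := by
  have h1 : ∀ j : ℤ, Continuous fun u : UnitaryMat n =>
      Matrix.trace (A * ((u ^ j : UnitaryMat n) : Matrix (Fin n) (Fin n) ℂ)) := fun j =>
    (continuous_const.matrix_mul (continuous_zpow_val j)).matrix_trace
  have h2 : Continuous fun u : UnitaryMat n => (∑ i ∈ Finset.range k,
      (u : Matrix (Fin n) (Fin n) ℂ) ^ i * A * (u : Matrix (Fin n) (Fin n) ℂ) ^ (k - i)) :=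
    by fun_prop
  have h3 : Continuous fun u : UnitaryMat n => (u : Matrix (Fin n) (Fin n) ℂ) ^ k := by fun_prop
  unfold entryVariation
  exact ((h2.matrix_elem a b).mul (continuous_traceEval F)).add ((h3.matrix_elem a b).mul
    (continuous_finsetSum _ fun j _ => (continuous_const.mul (h1 j)).mul
      (continuous_traceEval _)))

lemma entryVariation_add (k : ℕ) (F : MvPolynomial ℤ ℂ) (a b : Fin n)
    (A B : Matrix (Fin n) (Fin n) ℂ) (u : UnitaryMat n) :
    entryVariation k F a b (A + B) u = entryVariation k F a b A u + entryVariation k F a b B u := by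
  simp only [entryVariation, mul_add, add_mul, Finset.sum_add_distrib, Matrix.add_apply,
    Matrix.trace_add]
  ring

lemma entryVariation_smul (k : ℕ) (F : MvPolynomial ℤ ℂ) (a b : Fin n) (c : ℂ)
    (A : Matrix (Fin n) (Fin n) ℂ) (u : UnitaryMat n) :
    entryVariation k F a b (c • A) u = c * entryVariation k F a b A u := by
  simp only [entryVariation, mul_smul_comm, smul_mul_assoc, ← Finset.smul_sum, Matrix.smul_apply,
    Matrix.trace_smul, smul_eq_mul, mul_add, Finset.mul_sum]
  congr 1
  · ring
  · refine Finset.sum_congr rfl fun j _ => ?_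
    ring

variable {μ : Measure (UnitaryMat n)} [IsProbabilityMeasure μ] [μ.IsMulLeftInvariant]

lemma integral_entryVariation_of_skew (k : ℕ) (F : MvPolynomial ℤ ℂ) (a b : Fin n)
    {A : Matrix (Fin n) (Fin n) ℂ} (hA : star A = -A) :
    ∫ u, entryVariation k F a b A u ∂μ = 0 := by
  refine integral_deriv_eq_zero hA
    (f := fun u => ((u : Matrix (Fin n) (Fin n) ℂ) ^ k) a b * traceEval u F) ?_
    (continuous_entryVariation k F a b A) fun u => ?_
  · have h3 : Continuous fun u : UnitaryMat n => (u : Matrix (Fin n) (Fin n) ℂ) ^ k := by fun_prop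
    exact (h3.matrix_elem a b).mul (continuous_traceEval F)
  · have h := (hasEntryDeriv_pow_expUnitaryMat_mul hA u k a b).fun_mul (hasDerivAt_traceEval hA u F)
    refine h.congr_deriv ?_
    simp only [expUnitaryMat_zero, one_mul, entryVariation]

lemma integral_entryVariation (k : ℕ) (F : MvPolynomial ℤ ℂ) (a b : Fin n)
    (A : Matrix (Fin n) (Fin n) ℂ) : ∫ u, entryVariation k F a b A u ∂μ = 0 := by
  have hdecomp : A = (1 / 2 : ℂ) • (A - star A) + (-Complex.I / 2) • (Complex.I • (A + star A)) := by
    rw [smul_smul]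
    have : -Complex.I / 2 * Complex.I = 1 / 2 := by
      rw [div_mul_eq_mul_div, neg_mul, Complex.I_mul_I, neg_neg]
    rw [this, ← smul_add, sub_add_add_cancel, ← two_smul ℂ A, smul_smul]
    norm_num
  have h1 : star (A - star A) = -(A - star A) := by simp
  have h2 : star (Complex.I • (A + star A)) = -(Complex.I • (A + star A)) := by
    rw [star_smul, star_add, star_star, add_comm (star A)]
    simp [add_comm]
  generalize A - star A = P at hdecomp h1
  generalize Complex.I • (A + star A) = Q at hdecomp h2
  subst hdecomp
  simp only [entryVariation_add, entryVariation_smul]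
  rw [integral_add, integral_const_mul, integral_const_mul, integral_entryVariation_of_skew _ _ _ _ h1,
    integral_entryVariation_of_skew _ _ _ _ h2, mul_zero, mul_zero, add_zero]
  · exact (integrable_of_continuous (continuous_entryVariation k F a b _)).const_mul _
  · exact (integrable_of_continuous (continuous_entryVariation k F a b _)).const_mul _

lemma sum_entryVariation_single (k : ℕ) (F : MvPolynomial ℤ ℂ) (u : UnitaryMat n) :
    ∑ a, ∑ b, entryVariation k F a b (Matrix.single a b 1) u =
      traceEval u ((∑ i ∈ Finset.range k, X (i : ℤ) * X ((k : ℤ) - i)) * F +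
        shiftDerivation k F) := by
  have hsplit : ∀ P Q : Matrix (Fin n) (Fin n) ℂ,
      ∑ a, ∑ b, (P * Matrix.single a b (1 : ℂ) * Q : Matrix (Fin n) (Fin n) ℂ) a b = P.trace * Q.trace := by
    intro P Q
    simp only [Matrix.trace, Matrix.diag, Finset.sum_mul_sum]
    refine Finset.sum_congr rfl fun a _ => Finset.sum_congr rfl fun b _ => ?_
    rw [mul_assoc, Matrix.mul_apply, Finset.sum_eq_single a]
    · simp
    · intro c _ hc
      rw [Matrix.single_mul_apply_of_ne _ _ _ _ _ hc, mul_zero]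
    · simp
  have htr : ∀ (P Q : Matrix (Fin n) (Fin n) ℂ),
      ∑ a, ∑ b, P a b * Matrix.trace (Matrix.single a b 1 * Q) = (P * Q).trace := by
    intro P Q
    rw [Matrix.trace]
    refine Finset.sum_congr rfl fun a _ => ?_
    rw [Matrix.diag, Matrix.mul_apply]
    refine Finset.sum_congr rfl fun b _ => ?_
    congr 1
    rw [Matrix.trace, Finset.sum_eq_single a]
    · simp
    · intro c _ hc
      rw [Matrix.diag, Matrix.single_mul_apply_of_ne _ _ _ _ _ hc]
    · simp
  rw [map_add, map_mul, derivation_eq_sum_vars (shiftDerivation k) F, map_sum, map_sum]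
  simp only [entryVariation, Finset.sum_add_distrib, Matrix.sum_apply, Finset.sum_mul,
    Finset.mul_sum]
  congr 1
  · rw [Finset.sum_congr rfl fun a _ => Finset.sum_comm, Finset.sum_comm]
    refine Finset.sum_congr rfl fun i hi => ?_
    simp only [← Finset.sum_mul]
    rw [hsplit, map_mul, traceEval_X, traceEval_X, powTr_natCast,
      ← Nat.cast_sub (Finset.mem_range.mp hi).le, powTr_natCast]
  · rw [Finset.sum_congr rfl fun a _ => Finset.sum_comm, Finset.sum_comm]
    refine Finset.sum_congr rfl fun j _ => ?_
    have h := htr ((u : Matrix (Fin n) (Fin n) ℂ) ^ k)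
      ((u ^ j : UnitaryMat n) : Matrix (Fin n) (Fin n) ℂ)
    rw [map_mul, shiftDerivation, mkDerivation_X, map_mul, traceEval_C, traceEval_X]
    have hp : powTr u (k + j) = ((u : Matrix (Fin n) (Fin n) ℂ) ^ k *
        ((u ^ j : UnitaryMat n) : Matrix (Fin n) (Fin n) ℂ)).trace := by
      rw [powTr, zpow_add, zpow_natCast]
      rfl
    rw [hp, ← h, Finset.mul_sum, Finset.sum_mul]
    refine Finset.sum_congr rfl fun a _ => ?_
    rw [Finset.mul_sum, Finset.sum_mul]
    refine Finset.sum_congr rfl fun b _ => ?_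
    ring

/-- The loop (Schwinger-Dyson) equations for the power traces of a Haar unitary matrix. -/
theorem loop_equation (k : ℕ) (F : MvPolynomial ℤ ℂ) :
    ∫ u, traceEval u ((∑ i ∈ Finset.range k, X (i : ℤ) * X ((k : ℤ) - i)) * F +
        shiftDerivation k F) ∂μ = 0 := by
  simp only [← sum_entryVariation_single]
  have hint : ∀ a b, Integrable (fun u => entryVariation k F a b (Matrix.single a b 1) u) μ :=
    fun a b => integrable_of_continuous (continuous_entryVariation k F a b _)
  rw [integral_finsetSum _ fun a _ => integrable_finsetSum _ fun b _ => hint a b]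
  refine Finset.sum_eq_zero fun a _ => ?_
  rw [integral_finsetSum _ fun b _ => hint a b]
  exact Finset.sum_eq_zero fun b _ => integral_entryVariation k F a b _

end LoopEquation

section Moments

open MvPolynomial

/-- The monomial `∏_{j ∈ s} X_j`. -/
noncomputable def posMon (s : Multiset ℕ) : MvPolynomial ℤ ℂ :=
  (s.map fun j : ℕ => (X (j : ℤ) : MvPolynomial ℤ ℂ)).prod

/-- The monomial `∏_{j ∈ t} X_{-j}`. -/
noncomputable def negMon (t : Multiset ℕ) : MvPolynomial ℤ ℂ :=
  (t.map fun j : ℕ => (X (-(j : ℤ)) : MvPolynomial ℤ ℂ)).prod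

@[simp] lemma posMon_zero : posMon 0 = 1 := by simp [posMon]
@[simp] lemma negMon_zero : negMon 0 = 1 := by simp [negMon]

@[simp] lemma posMon_cons (j : ℕ) (s : Multiset ℕ) : posMon (j ::ₘ s) = X (j : ℤ) * posMon s := by
  simp [posMon]

@[simp] lemma negMon_cons (j : ℕ) (s : Multiset ℕ) :
    negMon (j ::ₘ s) = X (-(j : ℤ)) * negMon s := by
  simp [negMon]

lemma posMon_add (s t : Multiset ℕ) : posMon (s + t) = posMon s * posMon t := by
  simp [posMon]

lemma negMon_add (s t : Multiset ℕ) : negMon (s + t) = negMon s * negMon t := by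
  simp [negMon]

lemma derivation_prod_map (D : Derivation ℂ (MvPolynomial ℤ ℂ) (MvPolynomial ℤ ℂ))
    (f : ℕ → MvPolynomial ℤ ℂ) (s : Multiset ℕ) :
    D (s.map f).prod = (s.map fun j => D (f j) * ((s.erase j).map f).prod).sum := by
  induction s using Multiset.induction_on with
  | empty => simp
  | cons a s ih =>
    rw [Multiset.map_cons, Multiset.prod_cons, Derivation.leibniz, ih, Multiset.map_cons,
      Multiset.sum_cons, Multiset.erase_cons_head, smul_eq_mul, smul_eq_mul, add_comm,
      mul_comm (D (f a)), ← Multiset.sum_map_mul_left]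
    congr 2
    refine Multiset.map_congr rfl fun j hj => ?_
    rw [Multiset.erase_cons_tail_of_mem hj, Multiset.map_cons, Multiset.prod_cons]
    ring

lemma sum_map_eq_sum_range {M : Type*} [AddCommMonoid M] (f : ℕ → M) (s : Multiset ℕ) {N : ℕ}
    (hs : ∀ j ∈ s, j < N) : (s.map f).sum = ∑ j ∈ Finset.range N, s.count j • f j := by
  rw [Finset.sum_multiset_map_count]
  refine Finset.sum_subset (fun j hj => ?_) fun j _ hj => ?_
  · exact Finset.mem_range.mpr (hs j (Multiset.mem_toFinset.mp hj))
  · rw [Multiset.count_eq_zero.mpr (fun h => hj (Multiset.mem_toFinset.mpr h)), zero_smul]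

lemma derivation_posMon (D : Derivation ℂ (MvPolynomial ℤ ℂ) (MvPolynomial ℤ ℂ)) (s : Multiset ℕ)
    {N : ℕ} (hs : ∀ j ∈ s, j < N) :
    D (posMon s) = ∑ j ∈ Finset.range N, s.count j • (D (X (j : ℤ)) * posMon (s.erase j)) := by
  rw [posMon, derivation_prod_map, sum_map_eq_sum_range _ _ hs]
  rfl

lemma derivation_negMon (D : Derivation ℂ (MvPolynomial ℤ ℂ) (MvPolynomial ℤ ℂ)) (t : Multiset ℕ)
    {N : ℕ} (ht : ∀ j ∈ t, j < N) :
    D (negMon t) = ∑ j ∈ Finset.range N, t.count j • (D (X (-(j : ℤ))) * negMon (t.erase j)) := by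
  rw [negMon, derivation_prod_map, sum_map_eq_sum_range _ _ ht]
  rfl

lemma lt_succ_of_sum_le {s : Multiset ℕ} {n : ℕ} (hs : s.sum ≤ n) (j : ℕ) (hj : j ∈ s) :
    j < n + 1 :=
  Nat.lt_succ_of_le ((Multiset.single_le_sum (fun _ _ => Nat.zero_le _) _ hj).trans hs)

lemma card_le_sum_of_zero_notMem {s : Multiset ℕ} (hs : 0 ∉ s) : s.card ≤ s.sum := by
  have := Multiset.card_nsmul_le_sum (s := s) (a := 1) fun x hx =>
    Nat.one_le_iff_ne_zero.mpr fun h => hs (h ▸ hx)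
  simpa using this

lemma sum_range_count_mul {s : Multiset ℕ} {n : ℕ} (hs : s.sum ≤ n) :
    ∑ j ∈ Finset.range (n + 1), s.count j * j = s.sum := by
  have := sum_map_eq_sum_range (fun j => j) s (lt_succ_of_sum_le hs)
  simpa using this.symm

variable {n : ℕ}

/-- The expectation of a polynomial in the power traces. -/
noncomputable def traceExp (μ : Measure (UnitaryMat n)) [IsProbabilityMeasure μ] :
    MvPolynomial ℤ ℂ →ₗ[ℂ] ℂ where
  toFun F := ∫ u, traceEval u F ∂μ
  map_add' F G := by
    simp only [map_add]
    exact integral_add (integrable_of_continuous (continuous_traceEval F))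
      (integrable_of_continuous (continuous_traceEval G))
  map_smul' a F := by
    simp only [map_smul, smul_eq_mul, RingHom.id_apply]
    exact integral_const_mul a _

variable (μ : Measure (UnitaryMat n)) [IsProbabilityMeasure μ]

lemma traceExp_apply (F : MvPolynomial ℤ ℂ) : traceExp μ F = ∫ u, traceEval u F ∂μ := rfl

lemma traceExp_X_zero_mul (F : MvPolynomial ℤ ℂ) : traceExp μ (X 0 * F) = n * traceExp μ F := by
  simp only [traceExp_apply, map_mul, traceEval_X, powTr_zero]
  exact integral_const_mul _ _

/-- The mixed moment of power traces indexed by a pair of multisets. -/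
noncomputable def mixedMoment (s t : Multiset ℕ) : ℂ := traceExp μ (posMon s * negMon t)

lemma traceEval_posMon_negMon_conj (u : UnitaryMat n) (s : Multiset ℕ) :
    traceEval u (negMon s) = conj (traceEval u (posMon s)) := by
  induction s using Multiset.induction_on with
  | empty => simp
  | cons a s ih => simp [ih, powTr_neg]

lemma norm_traceEval_posMon_le (u : UnitaryMat n) (s : Multiset ℕ) :
    ‖traceEval u (posMon s)‖ ≤ (n : ℝ) ^ s.card := by
  induction s using Multiset.induction_on with
  | empty => simp
  | cons a s ih =>
    rw [posMon_cons, map_mul, traceEval_X, norm_mul, Multiset.card_cons, pow_succ']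
    exact mul_le_mul (norm_powTr_le u _) ih (norm_nonneg _) (Nat.cast_nonneg _)

lemma mixedMoment_symm (s t : Multiset ℕ) : mixedMoment μ s t = conj (mixedMoment μ t s) := by
  simp only [mixedMoment, traceExp_apply, ← integral_conj, map_mul, traceEval_posMon_negMon_conj,
    Complex.conj_conj]
  simp only [mul_comm]

lemma norm_mixedMoment_le (s t : Multiset ℕ) :
    ‖mixedMoment μ s t‖ ≤ (n : ℝ) ^ (s.card + t.card) := by
  refine (norm_integral_le_of_norm_le_const (C := (n : ℝ) ^ (s.card + t.card))
    (Eventually.of_forall fun u => ?_)).trans (by simp)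
  rw [map_mul, norm_mul, traceEval_posMon_negMon_conj, RCLike.norm_conj, pow_add]
  gcongr <;> exact norm_traceEval_posMon_le u _

lemma mixedMoment_loop [μ.IsMulLeftInvariant] {k : ℕ} (hk : 1 ≤ k) {s t : Multiset ℕ}
    (hs : s.sum ≤ n) (ht : t.sum ≤ n) :
    n * mixedMoment μ (k ::ₘ s) t +
      ∑ i ∈ Finset.Ico 1 k, mixedMoment μ (i ::ₘ (k - i) ::ₘ s) t +
      ∑ j ∈ Finset.range (n + 1), (s.count j * j : ℂ) * mixedMoment μ ((k + j) ::ₘ s.erase j) t =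
      ∑ j ∈ Finset.range (n + 1), (t.count j * j : ℂ) *
        traceExp μ (X ((k : ℤ) - j) * (posMon s * negMon (t.erase j))) := by
  have h := loop_equation (μ := μ) k (posMon s * negMon t)
  rw [← traceExp_apply, map_add, Derivation.leibniz, derivation_posMon _ s (lt_succ_of_sum_le hs),
    derivation_negMon _ t (lt_succ_of_sum_le ht), Finset.range_eq_Ico,
    Finset.sum_eq_sum_Ico_succ_bot hk, add_mul, map_add, smul_eq_mul, smul_eq_mul, map_add,
    Finset.mul_sum, Finset.mul_sum, Finset.sum_mul, map_sum, map_sum, map_sum] at h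
  rw [← sub_eq_zero, ← h, sub_eq_add_neg, ← Finset.sum_neg_distrib, Finset.range_eq_Ico]
  have e1 : (n : ℂ) * mixedMoment μ (k ::ₘ s) t =
      traceExp μ (X ((0 : ℕ) : ℤ) * X ((k : ℤ) - (0 : ℕ)) * (posMon s * negMon t)) := by
    rw [mul_assoc]
    simp only [Nat.cast_zero, sub_zero]
    rw [traceExp_X_zero_mul, mixedMoment, posMon_cons, mul_assoc]
  have e2 : ∀ i ∈ Finset.Ico (0 + 1) k, mixedMoment μ (i ::ₘ (k - i) ::ₘ s) t =
      traceExp μ (X (i : ℤ) * X ((k : ℤ) - i) * (posMon s * negMon t)) := by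
    intro i hi
    rw [mixedMoment, posMon_cons, posMon_cons, Nat.cast_sub (Finset.mem_Ico.mp hi).2.le]
    congr 1
    ring
  have e3 : ∀ j ∈ Finset.Ico 0 (n + 1),
      (s.count j * j : ℂ) * mixedMoment μ ((k + j) ::ₘ s.erase j) t =
      traceExp μ (negMon t * s.count j • (shiftDerivation k (X (j : ℤ)) * posMon (s.erase j))) := by
    intro j _
    rw [mixedMoment, posMon_cons, ← smul_eq_mul, ← map_smul, shiftDerivation, mkDerivation_X]
    congr 1
    rw [MvPolynomial.smul_eq_C_mul, nsmul_eq_mul]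
    push_cast
    simp only [map_mul, map_natCast]
    ring
  have e4 : ∀ j ∈ Finset.Ico 0 (n + 1), -((t.count j * j : ℂ) *
        traceExp μ (X ((k : ℤ) - j) * (posMon s * negMon (t.erase j)))) =
      traceExp μ (posMon s *
        t.count j • (shiftDerivation k (X (-(j : ℤ))) * negMon (t.erase j))) := by
    intro j _
    rw [← neg_mul, ← smul_eq_mul, ← map_smul, shiftDerivation, mkDerivation_X]
    congr 1
    rw [MvPolynomial.smul_eq_C_mul, nsmul_eq_mul, ← sub_eq_add_neg]
    push_cast
    simp only [map_mul, map_natCast, map_neg]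
    ring
  rw [e1, Finset.sum_congr rfl e2, Finset.sum_congr rfl e3, Finset.sum_congr rfl e4]
  ring

/-- The defect in the Gaussian integration by parts formula for power traces. -/
noncomputable def momentDefect (k : ℕ) (s t : Multiset ℕ) : ℂ :=
  mixedMoment μ (k ::ₘ s) t - (k * t.count k : ℂ) * mixedMoment μ s (t.erase k)

lemma mixedMoment_cons (k : ℕ) (s t : Multiset ℕ) : mixedMoment μ (k ::ₘ s) t =
    momentDefect μ k s t + (k * t.count k : ℂ) * mixedMoment μ s (t.erase k) := by
  rw [momentDefect, sub_add_cancel]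

lemma sum_erase_add {s : Multiset ℕ} {j : ℕ} (hj : j ∈ s) : (s.erase j).sum + j = s.sum := by
  conv_rhs => rw [← Multiset.cons_erase hj, Multiset.sum_cons, add_comm]

/-- The loop equation rewritten for the defects. -/
lemma momentDefect_loop [μ.IsMulLeftInvariant] {k : ℕ} (hk : 1 ≤ k) {s t : Multiset ℕ}
    (hs : k + s.sum ≤ n) (ht : t.sum ≤ n)
    (ih : ∀ j ∈ t, k < j → momentDefect μ (j - k) (t.erase j) s = 0) :
    n * momentDefect μ k s t = -(∑ i ∈ Finset.Ico 1 k, momentDefect μ i ((k - i) ::ₘ s) t +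
      ∑ j ∈ Finset.range (n + 1), (s.count j * j : ℂ) * momentDefect μ (k + j) (s.erase j) t) := by
  have h := mixedMoment_loop μ hk (by omega : s.sum ≤ n) ht
  rw [mixedMoment_cons, Finset.sum_congr rfl fun i _ => mixedMoment_cons μ i ((k - i) ::ₘ s) t,
    Finset.sum_congr rfl fun j _ => congrArg _ (mixedMoment_cons μ (k + j) (s.erase j) t)] at h
  set T : ℕ → ℂ := fun j => (t.count j * j : ℂ) *
        traceExp μ (X ((k : ℤ) - j) * (posMon s * negMon (t.erase j))) with hT
  have hT0 : ∑ j ∈ Finset.range (n + 1), T j =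
      ∑ i ∈ Finset.Ico 1 k, T i + T k + ∑ j ∈ Finset.Ico (k + 1) (n + 1), T j := by
    rw [Finset.range_eq_Ico, Finset.sum_eq_sum_Ico_succ_bot (by omega : 0 < n + 1),
      ← Finset.sum_Ico_consecutive T (by omega : 0 + 1 ≤ k) (by omega : k ≤ n + 1),
      Finset.sum_eq_sum_Ico_succ_bot (by omega : k < n + 1)]
    simp only [hT]
    simp
    ring
  have hT1 : ∑ i ∈ Finset.Ico 1 k, T i = ∑ i ∈ Finset.Ico 1 k,
      (i * t.count i : ℂ) * mixedMoment μ ((k - i) ::ₘ s) (t.erase i) := by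
    refine Finset.sum_congr rfl fun i hi => ?_
    rw [hT, mixedMoment, posMon_cons, Nat.cast_sub (Finset.mem_Ico.mp hi).2.le, mul_assoc (X _)]
    ring
  have hTk : T k = n * ((k * t.count k : ℂ) * mixedMoment μ s (t.erase k)) := by
    simp only [hT, sub_self, traceExp_X_zero_mul, mixedMoment]
    ring
  have hT2 : ∑ j ∈ Finset.Ico (k + 1) (n + 1), T j = ∑ j ∈ Finset.range (n + 1),
      (s.count j * j : ℂ) * (((k + j : ℕ) * t.count (k + j) : ℂ) *
        mixedMoment μ (s.erase j) (t.erase (k + j))) := by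
    have hlow : ∀ j ∈ Finset.Ico (k + 1) (n + 1), T j = (t.count j * j : ℂ) *
        (((j - k : ℕ) * s.count (j - k) : ℂ) * mixedMoment μ (s.erase (j - k)) (t.erase j)) := by
      intro j hj
      obtain ⟨hj1, hj2⟩ := Finset.mem_Ico.mp hj
      by_cases hjt : j ∈ t
      · have h1 := ih j hjt hj1
        rw [momentDefect, sub_eq_zero] at h1
        have h2 := congrArg conj h1
        rw [← mixedMoment_symm, map_mul, ← mixedMoment_symm] at h2
        simp only [map_mul, Complex.conj_natCast] at h2
        rw [← h2, hT, mixedMoment, negMon_cons, Nat.cast_sub (by omega : k ≤ j), neg_sub, mul_left_comm]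
      · simp [hT, Multiset.count_eq_zero.mpr hjt]
    rw [Finset.sum_congr rfl hlow, show Finset.Ico (k + 1) (n + 1) =
      Finset.Ico (1 + k) (n + 1 - k + k) by congr 1 <;> omega, ← Finset.sum_Ico_add']
    simp only [Nat.add_sub_cancel]
    rw [Finset.sum_subset (s₁ := Finset.Ico 1 (n + 1 - k)) (s₂ := Finset.range (n + 1))]
    · refine Finset.sum_congr rfl fun j _ => ?_
      rw [add_comm j k]
      ring
    · intro j hj
      rw [Finset.mem_Ico] at hj
      rw [Finset.mem_range]
      omega
    · intro j hj hj'
      rw [Finset.mem_range] at hj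
      rw [Finset.mem_Ico, not_and_or] at hj'
      rcases Nat.eq_zero_or_pos j with rfl | hpos
      · simp
      · have : j + k ∉ t := fun hmem => by
          have := lt_succ_of_sum_le ht _ hmem
          omega
        simp [Multiset.count_eq_zero.mpr this]
  rw [hT0, hT1, hTk, hT2] at h
  simp only [mul_add, Finset.sum_add_distrib] at h
  linear_combination h

lemma norm_momentDefect_le {k : ℕ} {s t : Multiset ℕ} (hn : 1 ≤ n) (hk : 1 ≤ k)
    (hs : k + s.sum ≤ n) (ht : t.sum ≤ n) (hs0 : 0 ∉ s) (ht0 : 0 ∉ t) :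
    ‖momentDefect μ k s t‖ ≤ (n : ℝ) ^ (n + n) + n * n * (n : ℝ) ^ (n + n) := by
  have hn' : (1 : ℝ) ≤ n := by exact_mod_cast hn
  have hs1 := card_le_sum_of_zero_notMem hs0
  have ht1 := card_le_sum_of_zero_notMem ht0
  have ht2 := Multiset.card_le_card (Multiset.erase_le k t)
  have ht3 := Multiset.count_le_card k t
  refine (norm_sub_le _ _).trans (add_le_add ?_ ?_)
  · refine (norm_mixedMoment_le μ _ _).trans (pow_le_pow_right₀ hn' ?_)
    rw [Multiset.card_cons]
    omega
  · rw [norm_mul, norm_mul, Complex.norm_natCast, Complex.norm_natCast]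
    refine mul_le_mul (mul_le_mul ?_ ?_ (by positivity) (by positivity)) ?_ (by positivity)
      (by positivity)
    · exact_mod_cast (by omega : k ≤ n)
    · exact_mod_cast (by omega : t.count k ≤ n)
    · refine (norm_mixedMoment_le μ _ _).trans (pow_le_pow_right₀ hn' ?_)
      omega

lemma momentDefect_eq_zero_of_lower [μ.IsMulLeftInvariant] (hn : 1 ≤ n) {t : Multiset ℕ}
    (ht : t.sum ≤ n) (ht0 : 0 ∉ t) (d : ℕ) (hd : d ≤ n)
    (ih : ∀ k s, 1 ≤ k → 0 ∉ s → k + s.sum = d → ∀ j ∈ t, k < j →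
      momentDefect μ (j - k) (t.erase j) s = 0) :
    ∀ k s, 1 ≤ k → 0 ∉ s → k + s.sum = d → momentDefect μ k s t = 0 := by
  have hn' : (0 : ℝ) < n := by exact_mod_cast hn
  set K : ℝ := (n : ℝ) ^ (n + n) + n * n * (n : ℝ) ^ (n + n) with hK
  set q : ℝ := (n - 1) / n with hq
  have hn1 : (1 : ℝ) ≤ n := by exact_mod_cast hn
  have hq0 : 0 ≤ q := div_nonneg (by linarith) hn'.le
  have hq1 : q < 1 := by
    rw [hq, div_lt_one hn']
    linarith
  have key : ∀ r : ℕ, ∀ k s, 1 ≤ k → 0 ∉ s → k + s.sum = d →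
      ‖momentDefect μ k s t‖ ≤ q ^ r * K := by
    intro r
    induction r with
    | zero =>
      intro k s hk hs0 hs
      rw [pow_zero, one_mul]
      exact norm_momentDefect_le μ hn hk (by omega) ht hs0 ht0
    | succ r hr =>
      intro k s hk hs0 hs
      have hKr : 0 ≤ q ^ r * K := by positivity
      have h := momentDefect_loop μ hk (by omega) ht (ih k s hk hs0 hs)
      have h1 : ‖∑ i ∈ Finset.Ico 1 k, momentDefect μ i ((k - i) ::ₘ s) t‖ ≤
          ∑ i ∈ Finset.Ico 1 k, q ^ r * K := by
        refine norm_sum_le_of_le _ fun i hi => ?_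
        rw [Finset.mem_Ico] at hi
        refine hr _ _ hi.1 ?_ ?_
        · rw [Multiset.mem_cons, not_or]
          exact ⟨by omega, hs0⟩
        · rw [Multiset.sum_cons]
          omega
      have h2 : ‖∑ j ∈ Finset.range (n + 1), (s.count j * j : ℂ) *
          momentDefect μ (k + j) (s.erase j) t‖ ≤
          ∑ j ∈ Finset.range (n + 1), ((s.count j * j : ℕ) : ℝ) * (q ^ r * K) := by
        refine norm_sum_le_of_le _ fun j hj => ?_
        by_cases hjs : j ∈ s
        · rw [norm_mul, ← Nat.cast_mul, Complex.norm_natCast]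
          refine mul_le_mul_of_nonneg_left (hr _ _ (by omega) ?_ ?_) (Nat.cast_nonneg _)
          · exact fun h0 => hs0 (Multiset.mem_of_mem_erase h0)
          · have := sum_erase_add hjs
            omega
        · simp [Multiset.count_eq_zero.mpr hjs]
      rw [← Finset.sum_mul, ← Nat.cast_sum, sum_range_count_mul (by omega)] at h2
      rw [Finset.sum_const, Nat.card_Ico, nsmul_eq_mul] at h1
      have h3 := (norm_add_le _ _).trans (add_le_add h1 h2)
      rw [← norm_neg, ← h, norm_mul, Complex.norm_natCast, ← add_mul, ← Nat.cast_add] at h3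
      have h4 : ((k - 1 + s.sum : ℕ) : ℝ) ≤ n - 1 := by
        have h4' : k - 1 + s.sum + 1 ≤ n := by omega
        rw [le_sub_iff_add_le]
        exact_mod_cast h4'
      have h5 := h3.trans (mul_le_mul_of_nonneg_right h4 hKr)
      rw [pow_succ', hq, div_mul_eq_mul_div, div_mul_eq_mul_div, le_div_iff₀ hn', mul_assoc,
        mul_comm]
      exact h5
  intro k s hk hs0 hs
  have hlim : Tendsto (fun r : ℕ => q ^ r * K) atTop (𝓝 0) := by
    simpa using (tendsto_pow_atTop_nhds_zero_of_lt_one hq0 hq1).mul_const K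
  exact norm_le_zero_iff.mp (ge_of_tendsto' hlim fun r => key r k s hk hs0 hs)

/-- Exact Gaussian integration by parts for the power traces of small degree. -/
theorem momentDefect_eq_zero [μ.IsMulLeftInvariant] {k : ℕ} {s t : Multiset ℕ} (hk : 1 ≤ k)
    (hs : k + s.sum ≤ n) (ht : t.sum ≤ n) (hs0 : 0 ∉ s) (ht0 : 0 ∉ t) :
    momentDefect μ k s t = 0 := by
  induction hN : k + s.sum + t.sum using Nat.strong_induction_on generalizing k s t with
  | _ N ih =>
  refine momentDefect_eq_zero_of_lower μ (by omega) ht ht0 (k + s.sum) hs ?_ k s hk hs0 rfl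
  intro k' s' hk' hs0' hs' j hj hkj
  have := sum_erase_add hj
  exact ih _ (by omega) (by omega) (by omega) (by omega)
    (fun h0 => ht0 (Multiset.mem_of_mem_erase h0)) hs0' rfl

/-- The span of the monomials in the positive variables of weight at most `d`. -/
noncomputable def posSpan (d : ℕ) : Submodule ℂ (MvPolynomial ℤ ℂ) :=
  Submodule.span ℂ (posMon '' {s | 0 ∉ s ∧ s.sum ≤ d})

/-- The span of the monomials in the negative variables of weight at most `d`. -/
noncomputable def negSpan (d : ℕ) : Submodule ℂ (MvPolynomial ℤ ℂ) :=
  Submodule.span ℂ (negMon '' {s | 0 ∉ s ∧ s.sum ≤ d})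

lemma posSpan_mono {d e : ℕ} (h : d ≤ e) : posSpan d ≤ posSpan e :=
  Submodule.span_mono (Set.image_mono fun _ hs => ⟨hs.1, hs.2.trans h⟩)

lemma negSpan_mono {d e : ℕ} (h : d ≤ e) : negSpan d ≤ negSpan e :=
  Submodule.span_mono (Set.image_mono fun _ hs => ⟨hs.1, hs.2.trans h⟩)

lemma posSpan_mul_mem {d e : ℕ} {F G : MvPolynomial ℤ ℂ} (hF : F ∈ posSpan d)
    (hG : G ∈ posSpan e) : F * G ∈ posSpan (d + e) := by
  have h := Submodule.mul_mem_mul hF hG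
  rw [posSpan, posSpan, Submodule.span_mul_span] at h
  refine Submodule.span_mono ?_ h
  rintro _ ⟨_, ⟨s, hs, rfl⟩, _, ⟨t, ht, rfl⟩, rfl⟩
  refine ⟨s + t, ⟨?_, ?_⟩, posMon_add s t⟩
  · rw [Multiset.mem_add, not_or]
    exact ⟨hs.1, ht.1⟩
  · rw [Multiset.sum_add]
    exact add_le_add hs.2 ht.2

lemma negSpan_mul_mem {d e : ℕ} {F G : MvPolynomial ℤ ℂ} (hF : F ∈ negSpan d)
    (hG : G ∈ negSpan e) : F * G ∈ negSpan (d + e) := by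
  have h := Submodule.mul_mem_mul hF hG
  rw [negSpan, negSpan, Submodule.span_mul_span] at h
  refine Submodule.span_mono ?_ h
  rintro _ ⟨_, ⟨s, hs, rfl⟩, _, ⟨t, ht, rfl⟩, rfl⟩
  refine ⟨s + t, ⟨?_, ?_⟩, negMon_add s t⟩
  · rw [Multiset.mem_add, not_or]
    exact ⟨hs.1, ht.1⟩
  · rw [Multiset.sum_add]
    exact add_le_add hs.2 ht.2

lemma posSpan_pow_mem {d : ℕ} {F : MvPolynomial ℤ ℂ} (hF : F ∈ posSpan d) (a : ℕ) :
    F ^ a ∈ posSpan (a * d) := by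
  induction a with
  | zero => exact Submodule.subset_span ⟨0, by simp, by simp⟩
  | succ a ih =>
    rw [pow_succ, add_mul, one_mul]
    exact posSpan_mul_mem ih hF

lemma negSpan_pow_mem {d : ℕ} {F : MvPolynomial ℤ ℂ} (hF : F ∈ negSpan d) (a : ℕ) :
    F ^ a ∈ negSpan (a * d) := by
  induction a with
  | zero => exact Submodule.subset_span ⟨0, by simp, by simp⟩
  | succ a ih =>
    rw [pow_succ, add_mul, one_mul]
    exact negSpan_mul_mem ih hF

lemma pderiv_negMon (k : ℕ) (t : Multiset ℕ) :
    pderiv (-(k : ℤ)) (negMon t) = t.count k • negMon (t.erase k) := by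
  rw [derivation_negMon _ t (N := t.sum + k + 1), Finset.sum_eq_single k]
  · simp
  · intro j _ hj
    rw [pderiv_X_of_ne (by simpa using hj), zero_mul, smul_zero]
  · intro h
    exact absurd (Finset.mem_range.mpr (by omega)) h
  · intro j hj
    have := lt_succ_of_sum_le le_rfl j hj
    omega

theorem traceExp_X_mul [μ.IsMulLeftInvariant] {k : ℕ} (hk : 1 ≤ k) (hkn : k ≤ n)
    {F G : MvPolynomial ℤ ℂ} (hF : F ∈ posSpan (n - k)) (hG : G ∈ negSpan n) :
    traceExp μ (X (k : ℤ) * F * G) = k * traceExp μ (F * pderiv (-(k : ℤ)) G) := by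
  induction hF, hG using Submodule.span_induction₂ with
  | mem_mem F G hF hG =>
    obtain ⟨s, ⟨hs0, hs⟩, rfl⟩ := hF
    obtain ⟨t, ⟨ht0, ht⟩, rfl⟩ := hG
    have h := momentDefect_eq_zero μ hk (s := s) (by omega) ht hs0 ht0
    rw [momentDefect, sub_eq_zero, mixedMoment, mixedMoment, posMon_cons] at h
    rw [h, pderiv_negMon, mul_smul_comm, map_nsmul, nsmul_eq_mul, mul_assoc]
  | zero_left G hG => simp
  | zero_right F hF => simp
  | add_left F F' G _ _ _ h h' => simp only [mul_add, add_mul, map_add, h, h']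
  | add_right F G G' _ _ _ h h' => simp only [mul_add, map_add, h, h']
  | smul_left r F G _ _ h =>
    rw [mul_smul_comm, smul_mul_assoc, smul_mul_assoc, map_smul, map_smul, h, smul_eq_mul,
      smul_eq_mul, mul_left_comm]
  | smul_right r F G _ _ h =>
    rw [mul_smul_comm, map_smul, Derivation.map_smul, mul_smul_comm, map_smul, h, smul_eq_mul,
      smul_eq_mul, mul_left_comm]

end Moments

section LinearStatistics

open MvPolynomial

variable {n : ℕ} (μ : Measure (UnitaryMat n)) [IsProbabilityMeasure μ]

/-- The linear statistic `∑_{1 ≤ j ≤ m} a_j Tr (u ^ j)`. -/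
noncomputable def linStat (m : ℕ) (a : ℕ → ℂ) (u : UnitaryMat n) : ℂ :=
  ∑ j ∈ Finset.Ico 1 (m + 1), a j * powTr u j

@[fun_prop]
lemma continuous_linStat (m : ℕ) (a : ℕ → ℂ) :
    Continuous fun u : UnitaryMat n => linStat m a u :=
  continuous_finsetSum _ fun j _ => continuous_const.mul (continuous_powTr j)

/-- The limiting variance of `linStat`. -/
noncomputable def linVar (m : ℕ) (a : ℕ → ℂ) : ℝ :=
  ∑ j ∈ Finset.Ico 1 (m + 1), j * ‖a j‖ ^ 2

lemma linVar_nonneg (m : ℕ) (a : ℕ → ℂ) : 0 ≤ linVar m a :=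
  Finset.sum_nonneg fun _ _ => by positivity

noncomputable def posPoly (m : ℕ) (a : ℕ → ℂ) : MvPolynomial ℤ ℂ :=
  ∑ j ∈ Finset.Ico 1 (m + 1), a j • X (j : ℤ)

noncomputable def negPoly (m : ℕ) (a : ℕ → ℂ) : MvPolynomial ℤ ℂ :=
  ∑ j ∈ Finset.Ico 1 (m + 1), conj (a j) • X (-(j : ℤ))

lemma traceEval_posPoly (m : ℕ) (a : ℕ → ℂ) (u : UnitaryMat n) :
    traceEval u (posPoly m a) = linStat m a u := by
  simp [posPoly, linStat]

lemma traceEval_negPoly (m : ℕ) (a : ℕ → ℂ) (u : UnitaryMat n) :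
    traceEval u (negPoly m a) = conj (linStat m a u) := by
  simp [negPoly, linStat, powTr_neg]

lemma posPoly_mem (m : ℕ) (a : ℕ → ℂ) : posPoly m a ∈ posSpan m := by
  refine Submodule.sum_mem _ fun j hj => Submodule.smul_mem _ _ (Submodule.subset_span ?_)
  rw [Finset.mem_Ico] at hj
  exact ⟨{j}, ⟨by simp; omega, by simp; omega⟩, by simp [posMon]⟩

lemma negPoly_mem (m : ℕ) (a : ℕ → ℂ) : negPoly m a ∈ negSpan m := by
  refine Submodule.sum_mem _ fun j hj => Submodule.smul_mem _ _ (Submodule.subset_span ?_)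
  rw [Finset.mem_Ico] at hj
  exact ⟨{j}, ⟨by simp; omega, by simp; omega⟩, by simp [negMon]⟩

lemma pderiv_negPoly (m : ℕ) (a : ℕ → ℂ) {k : ℕ} (hk : k ∈ Finset.Ico 1 (m + 1)) :
    pderiv (-(k : ℤ)) (negPoly m a) = C (conj (a k)) := by
  rw [negPoly, map_sum, Finset.sum_eq_single_of_mem k hk]
  · rw [Derivation.map_smul, pderiv_X_self, smul_eq_C_mul, mul_one]
  · intro j _ hj
    rw [Derivation.map_smul, pderiv_X_of_ne (by simpa using hj), smul_zero]

lemma traceExp_posPoly_pow_succ [μ.IsMulLeftInvariant] (m : ℕ) (a : ℕ → ℂ) {p q : ℕ}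
    (hp : (p + 1) * m ≤ n) (hq : q * m ≤ n) :
    traceExp μ (posPoly m a ^ (p + 1) * negPoly m a ^ q) =
      q * linVar m a * traceExp μ (posPoly m a ^ p * negPoly m a ^ (q - 1)) := by
  have hterm : ∀ j ∈ Finset.Ico 1 (m + 1),
      traceExp μ (a j • X (j : ℤ) * posPoly m a ^ p * negPoly m a ^ q) =
      (j * ‖a j‖ ^ 2 : ℝ) * (q * traceExp μ (posPoly m a ^ p * negPoly m a ^ (q - 1))) := by
    intro j hj
    have hj' := Finset.mem_Ico.mp hj
    have hjm : j ≤ m := by omega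
    have hpm : p * m + m ≤ n := by rwa [add_mul, one_mul] at hp
    rw [smul_mul_assoc, smul_mul_assoc, map_smul, traceExp_X_mul μ hj'.1 (by omega)
      (posSpan_mono (by omega) (posSpan_pow_mem (posPoly_mem m a) p))
      (negSpan_mono hq (negSpan_pow_mem (negPoly_mem m a) q)), Derivation.leibniz_pow,
      pderiv_negPoly m a hj]
    have : posPoly m a ^ p * (q • (negPoly m a ^ (q - 1) • C (conj (a j)))) =
        (q * conj (a j) : ℂ) • (posPoly m a ^ p * negPoly m a ^ (q - 1)) := by
      rw [smul_eq_C_mul, nsmul_eq_mul, smul_eq_mul, map_mul, map_natCast]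
      ring
    rw [this, map_smul, smul_eq_mul, smul_eq_mul]
    push_cast
    rw [← Complex.mul_conj']
    ring
  rw [pow_succ', posPoly, Finset.sum_mul, Finset.sum_mul, map_sum, ← posPoly,
    Finset.sum_congr rfl hterm, ← Finset.sum_mul, linVar]
  push_cast
  ring

theorem integral_linStat_pow_mul_conj_pow [μ.IsMulLeftInvariant] (m : ℕ) (a : ℕ → ℂ) (p q : ℕ)
    (hp : p * m ≤ n) (hq : q * m ≤ n) :
    ∫ u, linStat m a u ^ p * conj (linStat m a u) ^ q ∂μ =
      if p = q then ((p.factorial * linVar m a ^ p : ℝ) : ℂ) else 0 := by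
  have hrepr : ∀ p q, ∫ u, linStat m a u ^ p * conj (linStat m a u) ^ q ∂μ =
      traceExp μ (posPoly m a ^ p * negPoly m a ^ q) := by
    intro p q
    simp only [traceExp_apply, map_mul, map_pow, traceEval_posPoly, traceEval_negPoly]
  have hzero : ∀ p, (p + 1) * m ≤ n → ∫ u, linStat m a u ^ (p + 1) ∂μ = 0 := by
    intro p hp
    have h := traceExp_posPoly_pow_succ μ m a hp (q := 0) (by simp)
    rw [← hrepr] at h
    simpa using h
  induction p generalizing q with
  | zero =>
    rcases q with _ | q
    · simp
    · have h := congrArg conj (hzero q hq)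
      rw [← integral_conj] at h
      simpa using h
  | succ p ih =>
    rw [hrepr, traceExp_posPoly_pow_succ μ m a hp hq, ← hrepr]
    rcases q with _ | q
    · simp
    · rw [Nat.add_sub_cancel, ih q ((Nat.mul_le_mul_right m (Nat.le_succ p)).trans hp)
        ((Nat.mul_le_mul_right m (Nat.le_succ q)).trans hq)]
      by_cases hpq : p = q
      · subst hpq
        simp only [if_true, Nat.factorial_succ]
        push_cast
        ring
      · simp [hpq]

end LinearStatistics

section CharacteristicFunction

open Complex in
lemma norm_cexp_sub_sum_le {c : ℂ} (hc : ‖c‖ = 1) (hre : c.re ≤ 0) (R : ℕ) {x : ℝ} (hx : 0 ≤ x) :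
    ‖cexp (c * x) - ∑ r ∈ Finset.range R, (c * x) ^ r / (r.factorial : ℂ)‖ ≤
      x ^ R / R.factorial := by
  induction R generalizing x with
  | zero =>
    simp only [Finset.range_zero, Finset.sum_empty, sub_zero, norm_exp, re_mul_ofReal, pow_zero,
      Nat.factorial_zero, Nat.cast_one, div_one]
    exact Real.exp_le_one_iff.mpr (mul_nonpos_of_nonpos_of_nonneg hre hx)
  | succ R ih =>
    have hd : ∀ y : ℝ, HasDerivAt (fun x : ℝ => cexp (c * x) -
        ∑ r ∈ Finset.range (R + 1), (c * x) ^ r / (r.factorial : ℂ))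
        (c * (cexp (c * y) - ∑ r ∈ Finset.range R, (c * y) ^ r / (r.factorial : ℂ))) y := by
      intro y
      have h0 : HasDerivAt (fun x : ℝ => c * (x : ℂ)) c y := by
        simpa using (hasDerivAt_id y).ofReal_comp.const_mul c
      have h1 := h0.cexp
      have h2 : HasDerivAt (fun x : ℝ => ∑ r ∈ Finset.range (R + 1),
          (c * (x : ℂ)) ^ r / (r.factorial : ℂ))
          (∑ r ∈ Finset.range (R + 1), ((r : ℂ) * (c * y) ^ (r - 1) * c) / (r.factorial : ℂ)) y :=
        HasDerivAt.fun_sum fun r _ => (h0.fun_pow r).div_const _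
      refine (h1.fun_sub h2).congr_deriv ?_
      rw [Finset.sum_range_succ']
      simp only [Nat.add_sub_cancel, Nat.factorial_succ, Nat.cast_zero, zero_mul, zero_div,
        add_zero, mul_sub, Finset.mul_sum]
      congr 1
      · ring
      · refine Finset.sum_congr rfl fun r _ => ?_
        have h3 : ((r.factorial : ℕ) : ℂ) ≠ 0 := by exact_mod_cast r.factorial_ne_zero
        have h4 : ((r + 1 : ℕ) : ℂ) ≠ 0 := by exact_mod_cast r.succ_ne_zero
        rw [Nat.cast_mul]
        field_simp
    refine image_norm_le_of_norm_deriv_right_le_deriv_boundary (a := 0) (b := x)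
      (f := fun x : ℝ => cexp (c * x) - ∑ r ∈ Finset.range (R + 1), (c * x) ^ r / (r.factorial : ℂ))
      (f' := fun y : ℝ => c * (cexp (c * y) -
        ∑ r ∈ Finset.range R, (c * y) ^ r / (r.factorial : ℂ)))
      (B := fun x => x ^ (R + 1) / (R + 1).factorial) (B' := fun x => x ^ R / R.factorial)
      (fun y _ => (hd y).continuousAt.continuousWithinAt) (fun y _ => (hd y).hasDerivWithinAt)
      ?_ ?_ ?_ ⟨hx, le_rfl⟩
    · simp [Finset.sum_range_succ']
    · intro y
      refine ((hasDerivAt_pow (R + 1) y).div_const _).congr_deriv ?_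
      rw [Nat.factorial_succ]
      have h3 : ((R.factorial : ℕ) : ℝ) ≠ 0 := by exact_mod_cast R.factorial_ne_zero
      push_cast
      have h4 : (R : ℝ) + 1 ≠ 0 := by positivity
      field_simp
    · intro y hy
      rw [norm_mul, hc, one_mul]
      exact ih hy.1

open Complex in
lemma norm_cexp_I_sub_sum_le (R : ℕ) (x : ℝ) :
    ‖cexp (I * x) - ∑ r ∈ Finset.range R, (I * x) ^ r / (r.factorial : ℂ)‖ ≤
      |x| ^ R / R.factorial := by
  rcases le_total 0 x with hx | hx
  · rw [abs_of_nonneg hx]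
    exact norm_cexp_sub_sum_le (by simp) (by simp) R hx
  · have h := norm_cexp_sub_sum_le (c := -I) (by simp) (by simp) R (neg_nonneg.mpr hx)
    rw [abs_of_nonpos hx]
    simpa only [ofReal_neg, neg_mul_neg] using h

variable {n : ℕ} (μ : Measure (UnitaryMat n)) [IsProbabilityMeasure μ] [μ.IsMulLeftInvariant]

lemma integral_re_linStat_pow (m : ℕ) (a : ℕ → ℂ) (r : ℕ) (hr : r * m ≤ n) :
    ∫ u, ((linStat m a u).re : ℂ) ^ r ∂μ =
      ∑ p ∈ Finset.range (r + 1), if p = r - p then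
        ((r.choose p * (p.factorial * linVar m a ^ p) / 2 ^ r : ℝ) : ℂ) else 0 := by
  have hexp : ∀ u : UnitaryMat n, ((linStat m a u).re : ℂ) ^ r = ∑ p ∈ Finset.range (r + 1),
      (r.choose p / 2 ^ r : ℂ) * (linStat m a u ^ p * conj (linStat m a u) ^ (r - p)) := by
    intro u
    rw [Complex.re_eq_add_conj, div_pow, add_pow, Finset.sum_div]
    refine Finset.sum_congr rfl fun p _ => ?_
    ring
  simp only [hexp]
  rw [integral_finsetSum]
  · refine Finset.sum_congr rfl fun p hp => ?_
    rw [Finset.mem_range] at hp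
    rw [integral_const_mul, integral_linStat_pow_mul_conj_pow μ m a p (r - p)
      ((Nat.mul_le_mul_right m (by omega)).trans hr) ((Nat.mul_le_mul_right m (by omega)).trans hr)]
    split_ifs
    · push_cast
      ring
    · simp
  · intro p _
    refine integrable_of_continuous ?_
    have := (Complex.continuous_conj).comp (continuous_linStat (n := n) m a)
    exact continuous_const.mul (((continuous_linStat m a).pow p).mul (this.pow (r - p)))

lemma integral_re_linStat_pow_odd (m : ℕ) (a : ℕ → ℂ) (r : ℕ) (hr : (2 * r + 1) * m ≤ n) :
    ∫ u, ((linStat m a u).re : ℂ) ^ (2 * r + 1) ∂μ = 0 := by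
  rw [integral_re_linStat_pow μ m a _ hr]
  refine Finset.sum_eq_zero fun p hp => if_neg ?_
  rw [Finset.mem_range] at hp
  omega

lemma integral_re_linStat_pow_even (m : ℕ) (a : ℕ → ℂ) (r : ℕ) (hr : 2 * r * m ≤ n) :
    ∫ u, ((linStat m a u).re : ℂ) ^ (2 * r) ∂μ =
      (((2 * r).factorial / r.factorial * (linVar m a / 4) ^ r : ℝ) : ℂ) := by
  rw [integral_re_linStat_pow μ m a _ hr, Finset.sum_eq_single_of_mem r (by simp; omega)]
  · rw [if_pos (by omega), Nat.cast_choose ℝ (by omega : r ≤ 2 * r), div_pow, pow_mul]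
    congr 1
    rw [show 2 * r - r = r by omega]
    have h3 : ((r.factorial : ℕ) : ℝ) ≠ 0 := by exact_mod_cast r.factorial_ne_zero
    field_simp
    norm_num
  · intro p hp hpr
    rw [Finset.mem_range] at hp
    exact if_neg (by omega)

lemma sum_range_two_mul {M : Type*} [AddCommMonoid M] (f : ℕ → M) (A : ℕ) :
    ∑ r ∈ Finset.range (2 * A), f r =
      ∑ r ∈ Finset.range A, (f (2 * r) + f (2 * r + 1)) := by
  induction A with
  | zero => simp
  | succ A ih =>
    rw [show 2 * (A + 1) = 2 * A + 1 + 1 by ring, Finset.sum_range_succ, Finset.sum_range_succ, ih,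
      Finset.sum_range_succ, add_assoc]

/-- Quantitative Gaussian approximation of the characteristic function of a linear statistic. -/
theorem norm_charFun_linStat_sub_le (m : ℕ) (a : ℕ → ℂ) (A : ℕ) (hA : 2 * A * m ≤ n) :
    ‖∫ u, Complex.exp (Complex.I * (linStat m a u).re) ∂μ - Real.exp (-(linVar m a / 4))‖ ≤
      2 * ((linVar m a / 4) ^ A / A.factorial) := by
  set s := linVar m a / 4 with hs
  have hs0 : 0 ≤ s := div_nonneg (linVar_nonneg m a) (by norm_num)
  have hre : Continuous fun u : UnitaryMat n => (((linStat m a u).re : ℝ) : ℂ) :=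
    Complex.continuous_ofReal.comp (Complex.continuous_re.comp (continuous_linStat m a))
  have hTcont : Continuous fun u : UnitaryMat n => ∑ r ∈ Finset.range (2 * A),
      (Complex.I * ((linStat m a u).re : ℂ)) ^ r / (r.factorial : ℂ) :=
    continuous_finsetSum _ fun r _ => ((continuous_const.mul hre).pow r).div_const _
  have hEcont : Continuous fun u : UnitaryMat n => Complex.exp (Complex.I * (linStat m a u).re) :=
    (continuous_const.mul hre).cexp
  have hT : ∫ u, ∑ r ∈ Finset.range (2 * A),
      (Complex.I * ((linStat m a u).re : ℂ)) ^ r / (r.factorial : ℂ) ∂μ =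
      ((∑ r ∈ Finset.range A, (-s) ^ r / r.factorial : ℝ) : ℂ) := by
    rw [integral_finsetSum]
    · have hterm : ∀ r : ℕ, ∫ u, (Complex.I * ((linStat m a u).re : ℂ)) ^ r / (r.factorial : ℂ) ∂μ =
          Complex.I ^ r / (r.factorial : ℂ) * ∫ u, ((linStat m a u).re : ℂ) ^ r ∂μ := by
        intro r
        rw [← integral_const_mul]
        congr 1
        funext u
        rw [mul_pow, mul_div_right_comm]
      simp only [hterm]
      rw [sum_range_two_mul, Complex.ofReal_sum]
      refine Finset.sum_congr rfl fun r hr => ?_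
      rw [Finset.mem_range] at hr
      rw [integral_re_linStat_pow_odd μ m a r ((Nat.mul_le_mul_right m (by omega)).trans hA),
        integral_re_linStat_pow_even μ m a r ((Nat.mul_le_mul_right m (by omega)).trans hA),
        mul_zero, add_zero, pow_mul, Complex.I_sq]
      have h3 : (((2 * r).factorial : ℕ) : ℂ) ≠ 0 := by exact_mod_cast (2 * r).factorial_ne_zero
      rw [← hs, neg_pow s]
      push_cast
      field_simp
    · intro r _
      exact integrable_of_continuous (((continuous_const.mul hre).pow r).div_const _)
  have h1 : ‖∫ u, Complex.exp (Complex.I * (linStat m a u).re) ∂μ -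
      ((∑ r ∈ Finset.range A, (-s) ^ r / r.factorial : ℝ) : ℂ)‖ ≤ s ^ A / A.factorial := by
    rw [← hT, ← integral_sub (integrable_of_continuous hEcont) (integrable_of_continuous hTcont)]
    have hcont : Continuous fun u : UnitaryMat n =>
        ((linStat m a u).re) ^ (2 * A) / ((2 * A).factorial : ℝ) :=
      ((Complex.continuous_re.comp (continuous_linStat m a)).pow _).div_const _
    refine (norm_integral_le_of_norm_le
      (g := fun u => ((linStat m a u).re) ^ (2 * A) / ((2 * A).factorial : ℝ))
      (hcont.integrable_of_hasCompactSupport (HasCompactSupport.of_compactSpace _))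
      (Eventually.of_forall fun u => ?_)).trans (le_of_eq ?_)
    · have h := norm_cexp_I_sub_sum_le (2 * A) (linStat m a u).re
      rwa [Even.pow_abs (even_two_mul A)] at h
    · have h2 := integral_re_linStat_pow_even μ m a A hA
      have h3 : ∫ u, (linStat m a u).re ^ (2 * A) ∂μ =
          (2 * A).factorial / A.factorial * (linVar m a / 4) ^ A := by
        apply Complex.ofReal_injective
        rw [← h2, ← integral_complex_ofReal]
        push_cast
        rfl
      rw [integral_div, h3, ← hs]
      have h4 : (((2 * A).factorial : ℕ) : ℝ) ≠ 0 := by exact_mod_cast (2 * A).factorial_ne_zero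
      field_simp
  have h2 := norm_cexp_sub_sum_le (c := -1) (by simp) (by simp) A hs0
  have h3 : ‖((∑ r ∈ Finset.range A, (-s) ^ r / r.factorial : ℝ) : ℂ) - Real.exp (-s)‖ ≤
      s ^ A / A.factorial := by
    rw [norm_sub_rev]
    simp only [neg_one_mul] at h2
    push_cast
    exact h2
  rw [two_mul]
  exact (norm_sub_le_norm_sub_add_norm_sub _ _ _).trans (add_le_add h1 h3)

end CharacteristicFunction

section Rotation

variable {n : ℕ}

/-- The scalar unitary matrix `e^{iθ}`. -/
noncomputable def scalarUnitary (n : ℕ) (θ : ℝ) : UnitaryMat n :=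
  ⟨Complex.exp (θ * Complex.I) • 1, by
    rw [Matrix.mem_unitaryGroup_iff, star_smul, star_one, smul_mul_smul_comm, one_mul,
      RCLike.star_def, Complex.mul_conj', Complex.norm_exp_ofReal_mul_I]
    simp⟩

lemma scalarUnitary_mul_val (θ : ℝ) (u : UnitaryMat n) :
    ((scalarUnitary n θ * u : UnitaryMat n) : Matrix (Fin n) (Fin n) ℂ) =
      Complex.exp (θ * Complex.I) • (u : Matrix (Fin n) (Fin n) ℂ) := by
  simp [scalarUnitary]

lemma powTr_scalarUnitary_mul (θ : ℝ) (u : UnitaryMat n) (k : ℕ) :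
    powTr (scalarUnitary n θ * u) k = Complex.exp (θ * Complex.I) ^ k * powTr u k := by
  rw [powTr_natCast, powTr_natCast, scalarUnitary_mul_val, smul_pow, Matrix.trace_smul,
    smul_eq_mul]

variable (μ : Measure (UnitaryMat n)) [μ.IsMulLeftInvariant]

lemma integral_powTr_natCast {k : ℕ} (hk : k ≠ 0) : ∫ u, powTr u k ∂μ = 0 := by
  have h := integral_mul_left_eq_self (μ := μ) (fun u => powTr u k) (scalarUnitary n (Real.pi / k))
  simp only [powTr_scalarUnitary_mul, integral_const_mul] at h
  rw [← Complex.exp_nat_mul] at h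
  have hk' : (k : ℂ) ≠ 0 := by exact_mod_cast hk
  have he : (k : ℂ) * (((Real.pi / k : ℝ) : ℂ) * Complex.I) = Real.pi * Complex.I := by
    push_cast
    field_simp
  rw [he, Complex.exp_pi_mul_I, neg_one_mul] at h
  exact self_eq_neg.mp h.symm

lemma integral_powTr [IsProbabilityMeasure μ] (j : ℤ) : ∫ u, powTr u j ∂μ = if j = 0 then (n : ℂ) else 0 := by
  split_ifs with hj
  · simp [hj, powTr_zero]
  · obtain ⟨k, rfl | rfl⟩ := j.eq_nat_or_neg
    · exact integral_powTr_natCast μ (by simpa using hj)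
    · simp only [powTr_neg]
      rw [integral_conj, integral_powTr_natCast μ (by simpa using hj), map_zero]

end Rotation

section TraceClass

variable {n : ℕ}

/-- Evaluation of the polynomial `∑_{k < N} c_k z ^ k` at a unitary matrix. -/
noncomputable def polyMat (N : ℕ) (c : ℕ → ℂ) (u : UnitaryMat n) : Matrix (Fin n) (Fin n) ℂ :=
  ∑ k ∈ Finset.range N, c k • (u : Matrix (Fin n) (Fin n) ℂ) ^ k

lemma continuous_polyMat (N : ℕ) (c : ℕ → ℂ) :
    Continuous fun u : UnitaryMat n => polyMat N c u := by
  unfold polyMat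
  fun_prop

lemma sum_norm_sq_polyMat (N : ℕ) (c : ℕ → ℂ) (u : UnitaryMat n) :
    ((∑ a, ∑ b, ‖polyMat N c u a b‖ ^ 2 : ℝ) : ℂ) =
      ∑ i ∈ Finset.range N, ∑ j ∈ Finset.range N, c i * conj (c j) * powTr u (i - j) := by
  have h1 : ((∑ a, ∑ b, ‖polyMat N c u a b‖ ^ 2 : ℝ) : ℂ) =
      Matrix.trace (polyMat N c u * star (polyMat N c u)) := by
    simp only [Matrix.trace, Matrix.diag, Matrix.mul_apply, Matrix.star_apply]
    push_cast
    refine Finset.sum_congr rfl fun a _ => Finset.sum_congr rfl fun b _ => ?_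
    rw [← Complex.mul_conj']
    rfl
  rw [h1, polyMat, star_sum, Finset.sum_mul_sum, Matrix.trace_sum]
  refine Finset.sum_congr rfl fun i _ => ?_
  rw [Matrix.trace_sum]
  refine Finset.sum_congr rfl fun j _ => ?_
  rw [star_smul, smul_mul_smul_comm, Matrix.trace_smul, powTr, sub_eq_add_neg, zpow_add,
    Submonoid.coe_mul, zpow_neg_val]
  simp

lemma trace_polyMat_mul_polyMat (N M : ℕ) (c d : ℕ → ℂ) (u : UnitaryMat n) :
    ‖Matrix.trace (polyMat N c u * polyMat M d u)‖ ≤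
      (∑ a, ∑ b, ‖polyMat N c u a b‖ ^ 2 + ∑ a, ∑ b, ‖polyMat M d u a b‖ ^ 2) / 2 := by
  have h2 : ∑ a, ∑ b, ‖polyMat M d u a b‖ ^ 2 = ∑ a, ∑ b, ‖polyMat M d u b a‖ ^ 2 :=
    Finset.sum_comm
  rw [h2, ← Finset.sum_add_distrib, Finset.sum_div]
  refine norm_sum_le_of_le _ fun a _ => ?_
  rw [Matrix.diag, Matrix.mul_apply, ← Finset.sum_add_distrib, Finset.sum_div]
  refine norm_sum_le_of_le _ fun b _ => ?_
  rw [norm_mul]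
  nlinarith [sq_nonneg (‖polyMat N c u a b‖ - ‖polyMat M d u b a‖)]

variable (μ : Measure (UnitaryMat n)) [IsProbabilityMeasure μ] [μ.IsMulLeftInvariant]

lemma integral_sum_norm_sq_polyMat (N : ℕ) (c : ℕ → ℂ) :
    ∫ u, ∑ a, ∑ b, ‖polyMat N c u a b‖ ^ 2 ∂μ = n * ∑ k ∈ Finset.range N, ‖c k‖ ^ 2 := by
  apply Complex.ofReal_injective
  rw [← integral_complex_ofReal]
  simp only [sum_norm_sq_polyMat]
  rw [integral_finsetSum _ fun i _ => integrable_of_continuous (by fun_prop), Finset.mul_sum]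
  push_cast
  refine Finset.sum_congr rfl fun i hi => ?_
  rw [integral_finsetSum _ fun j _ => integrable_of_continuous (by fun_prop)]
  simp only [integral_const_mul, integral_powTr]
  rw [Finset.sum_eq_single_of_mem i hi]
  · rw [sub_self, if_pos rfl, Complex.mul_conj']
    ring
  · intro j _ hj
    rw [if_neg, mul_zero]
    intro h
    exact hj (by omega)

lemma integral_norm_trace_polyMat_mul_polyMat_le (N M : ℕ) (c d : ℕ → ℂ) :
    ∫ u, ‖Matrix.trace (polyMat N c u * polyMat M d u)‖ ∂μ ≤
      n * (∑ k ∈ Finset.range N, ‖c k‖ ^ 2 + ∑ k ∈ Finset.range M, ‖d k‖ ^ 2) / 2 := by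
  have hcs : ∀ N c, Continuous fun u : UnitaryMat n => ∑ a, ∑ b, ‖polyMat N c u a b‖ ^ 2 :=
    fun N c => continuous_finsetSum _ fun a _ => continuous_finsetSum _ fun b _ =>
      (((continuous_polyMat N c).matrix_elem a b).norm).pow 2
  have hint : ∀ f : UnitaryMat n → ℝ, Continuous f → Integrable f μ := fun f hf =>
    hf.integrable_of_hasCompactSupport (HasCompactSupport.of_compactSpace f)
  refine (integral_mono (hint _ ?_) (hint _ ?_) (trace_polyMat_mul_polyMat N M c d)).trans_eq ?_
  · exact ((continuous_polyMat N c).matrix_mul (continuous_polyMat M d)).matrix_trace.norm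
  · exact ((hcs N c).add (hcs M d)).div_const 2
  · rw [integral_div, integral_add (hint _ (hcs N c)) (hint _ (hcs M d)),
      integral_sum_norm_sq_polyMat, integral_sum_norm_sq_polyMat, mul_add]

end TraceClass

section Tail

/-- The weight of the `j`-th power trace in the discarded tail of `log Z`. -/
noncomputable def tailWeight (m j : ℕ) : ℝ := min (j / (m : ℝ) ^ 2) (1 / j)

lemma tailWeight_zero (m : ℕ) : tailWeight m 0 = 0 := by simp [tailWeight]

lemma tailWeight_nonneg (m j : ℕ) : 0 ≤ tailWeight m j := by
  unfold tailWeight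
  positivity

lemma tailWeight_of_le {m j : ℕ} (hm : 1 ≤ m) (hj : j ≤ m) : tailWeight m j = j / (m : ℝ) ^ 2 := by
  rcases Nat.eq_zero_or_pos j with rfl | hj0
  · simp [tailWeight]
  refine min_eq_left ?_
  have hj0' : (0 : ℝ) < j := by exact_mod_cast hj0
  have hm' : (0 : ℝ) < m := by exact_mod_cast hm
  have hjm : (j : ℝ) ≤ m := by exact_mod_cast hj
  rw [div_le_div_iff₀ (by positivity) hj0']
  nlinarith

lemma tailWeight_of_ge {m j : ℕ} (hm : 1 ≤ m) (hj : m ≤ j) : tailWeight m j = 1 / j := by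
  refine min_eq_right ?_
  have hm' : (0 : ℝ) < m := by exact_mod_cast hm
  have hjm : (m : ℝ) ≤ j := by exact_mod_cast hj
  rw [div_le_div_iff₀ (hm'.trans_le hjm) (by positivity)]
  nlinarith

lemma tailWeight_le_one (m j : ℕ) : tailWeight m j ≤ 1 := by
  refine (min_le_right _ _).trans ?_
  rcases Nat.eq_zero_or_pos j with rfl | hj0
  · simp
  · rw [div_le_one (by exact_mod_cast hj0)]
    exact_mod_cast hj0

/-- The tail weights cut off after `N`, multiplied by `1 + m - m z`. -/
noncomputable def tailFactor (m N k : ℕ) : ℝ :=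
  (if k < N + 1 then (1 + m) * tailWeight m k else 0) - if k = 0 then 0 else m * tailWeight m (k - 1)

lemma tailFactor_sq_le {m N k : ℕ} (hm : 1 ≤ m) (hk : k < N + 1) (hmk : m < k) :
    tailFactor m N k ^ 2 ≤ ((k : ℝ) ^ 2)⁻¹ := by
  obtain ⟨l, rfl⟩ : ∃ l, k = l + 1 := ⟨k - 1, by omega⟩
  have hml : m ≤ l := by omega
  have hm' : (1 : ℝ) ≤ m := by exact_mod_cast hm
  have hml' : (m : ℝ) ≤ l := by exact_mod_cast hml
  have hl0 : (0 : ℝ) < l := by linarith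
  rw [tailFactor, if_pos hk, if_neg (by omega), Nat.add_sub_cancel, tailWeight_of_ge hm (by omega),
    tailWeight_of_ge hm hml, ← inv_pow]
  have h1 : (1 + (m : ℝ)) * (1 / (l + 1 : ℕ)) - m * (1 / l) =
      (1 - m / l) * ((l + 1 : ℕ) : ℝ)⁻¹ := by
    push_cast
    field_simp
    ring
  rw [h1, mul_pow]
  have h2 : (m : ℝ) / l ≤ 1 := (div_le_one hl0).mpr hml'
  have h3 : 0 ≤ (m : ℝ) / l := by positivity
  have h4 : (1 - (m : ℝ) / l) ^ 2 ≤ 1 := by nlinarith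
  exact mul_le_of_le_one_left (by positivity) h4

lemma tailFactor_sq_le_of_le {m N k : ℕ} (hm : 1 ≤ m) (hk : k < N + 1) (hmk : k ≤ m) :
    tailFactor m N k ^ 2 ≤ if k = 0 then 0 else 4 / (m : ℝ) ^ 2 := by
  split_ifs with h0
  · simp [h0, tailFactor, tailWeight_zero]
  obtain ⟨l, rfl⟩ : ∃ l, k = l + 1 := ⟨k - 1, by omega⟩
  have hm' : (1 : ℝ) ≤ m := by exact_mod_cast hm
  have hml' : ((l + 1 : ℕ) : ℝ) ≤ m := by exact_mod_cast hmk
  rw [tailFactor, if_pos hk, if_neg h0, Nat.add_sub_cancel, tailWeight_of_le hm hmk,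
    tailWeight_of_le hm (by omega)]
  have h1 : (1 + (m : ℝ)) * ((l + 1 : ℕ) / (m : ℝ) ^ 2) - m * (l / (m : ℝ) ^ 2) =
      ((l + 1 : ℕ) + m) / (m : ℝ) ^ 2 := by
    push_cast
    field_simp
    ring
  have h2 : ((l + 1 : ℕ) + m) / (m : ℝ) ^ 2 ≤ 2 / m := by
    rw [div_le_div_iff₀ (by positivity) (by positivity)]
    nlinarith
  rw [h1]
  calc _ ≤ (2 / (m : ℝ)) ^ 2 := pow_le_pow_left₀ (by positivity) h2 2
    _ = _ := by rw [div_pow]; norm_num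

lemma tailFactor_succ_sq_le {m N : ℕ} (hm : 1 ≤ m) (hN : m ^ 2 ≤ N) :
    tailFactor m N (N + 1) ^ 2 ≤ 1 / m := by
  have hm' : (1 : ℝ) ≤ m := by exact_mod_cast hm
  have hN' : (m : ℝ) ^ 2 ≤ N := by exact_mod_cast hN
  have hmN : m ≤ N := by nlinarith
  rw [tailFactor, if_neg (by omega), if_neg (by omega), Nat.add_sub_cancel,
    tailWeight_of_ge hm hmN, zero_sub, neg_sq]
  have hN0 : (0 : ℝ) < N := by nlinarith
  have h1 : (m : ℝ) * (1 / N) ≤ 1 / m := by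
    rw [mul_one_div, div_le_div_iff₀ hN0 (by positivity)]
    nlinarith
  calc _ ≤ (1 / (m : ℝ)) ^ 2 := pow_le_pow_left₀ (by positivity) h1 2
    _ ≤ (1 / (m : ℝ)) ^ 1 := pow_le_pow_of_le_one (by positivity)
        ((div_le_one (by positivity)).mpr hm') (by norm_num)
    _ = _ := pow_one _

lemma sum_tailFactor_sq_le {m N : ℕ} (hm : 1 ≤ m) (hN : m ^ 2 ≤ N) :
    ∑ k ∈ Finset.range (N + 2), tailFactor m N k ^ 2 ≤ 6 / m := by
  have hm' : (1 : ℝ) ≤ m := by exact_mod_cast hm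
  have hmN : m ≤ N := by nlinarith
  rw [Finset.sum_range_succ, Finset.range_eq_Ico,
    ← Finset.sum_Ico_consecutive _ (Nat.zero_le (m + 1)) (by omega : m + 1 ≤ N + 1)]
  have h1 : ∑ k ∈ Finset.Ico 0 (m + 1), tailFactor m N k ^ 2 ≤ 4 / m := by
    have : ∑ k ∈ Finset.Ico 0 (m + 1), tailFactor m N k ^ 2 ≤
        ∑ k ∈ Finset.range (m + 1), if k = 0 then 0 else 4 / (m : ℝ) ^ 2 := by
      rw [Finset.range_eq_Ico]
      refine Finset.sum_le_sum fun k hk => ?_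
      rw [Finset.mem_Ico] at hk
      exact tailFactor_sq_le_of_le hm (by omega) (by omega)
    refine this.trans (le_of_eq ?_)
    rw [Finset.sum_range_succ']
    simp
    field_simp
  have h2 : ∑ k ∈ Finset.Ico (m + 1) (N + 1), tailFactor m N k ^ 2 ≤ 1 / m := by
    have : ∑ k ∈ Finset.Ico (m + 1) (N + 1), tailFactor m N k ^ 2 ≤
        ∑ k ∈ Finset.Ioc m N, ((k : ℝ) ^ 2)⁻¹ := by
      have hI : Finset.Ico (m + 1) (N + 1) = Finset.Ioc m N := by
        ext k
        simp only [Finset.mem_Ico, Finset.mem_Ioc]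
        omega
      rw [hI]
      refine Finset.sum_le_sum fun k hk => ?_
      rw [Finset.mem_Ioc] at hk
      exact tailFactor_sq_le hm (by omega) hk.1
    refine this.trans ((sum_Ioc_inv_sq_le_sub (by omega) hmN).trans ?_)
    rw [one_div]
    exact sub_le_self _ (by positivity)
  have h3 := tailFactor_succ_sq_le hm hN
  calc _ ≤ 4 / (m : ℝ) + 1 / m + 1 / m := add_le_add (add_le_add h1 h2) h3
    _ = 6 / m := by ring

lemma sum_geom_sq_le {m : ℕ} (hm : 1 ≤ m) (N : ℕ) :
    ∑ k ∈ Finset.range N, ((1 + m : ℝ)⁻¹ * ((m : ℝ) / (1 + m)) ^ k) ^ 2 ≤ 1 / (m : ℝ) := by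
  have hm' : (1 : ℝ) ≤ m := by exact_mod_cast hm
  have h1 : ∀ k : ℕ, ((1 + m : ℝ)⁻¹ * ((m : ℝ) / (1 + m)) ^ k) ^ 2 =
      ((1 + m : ℝ)⁻¹) ^ 2 * (((m : ℝ) / (1 + m)) ^ 2) ^ k := fun k => by
    rw [mul_pow, ← pow_mul, ← pow_mul, mul_comm k 2]
  simp only [h1]
  rw [← Finset.mul_sum]
  have h2 := mul_neg_geom_sum (((m : ℝ) / (1 + m)) ^ 2) N
  set S := ∑ k ∈ Finset.range N, (((m : ℝ) / (1 + m)) ^ 2) ^ k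
  have h3 : 1 - ((m : ℝ) / (1 + m)) ^ 2 = (1 + 2 * m) * ((1 + m : ℝ)⁻¹) ^ 2 := by
    field_simp
    ring
  have h4 : (1 + 2 * m) * (((1 + m : ℝ)⁻¹) ^ 2 * S) ≤ 1 := by
    rw [← mul_assoc, ← h3, h2]
    exact sub_le_self _ (by positivity)
  rw [le_div_iff₀ (by positivity)]
  have h5 : 0 ≤ ((1 + m : ℝ)⁻¹) ^ 2 * S := by
    have : 0 ≤ S := Finset.sum_nonneg fun _ _ => by positivity
    positivity
  nlinarith

variable {n : ℕ}

/-- The truncated tail. -/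
noncomputable def tailSum (m N : ℕ) (x : ℂ) (u : UnitaryMat n) : ℂ :=
  ∑ j ∈ Finset.range (N + 1), tailWeight m j * x ^ j * powTr u j

lemma tailSum_factor {m : ℕ} (N : ℕ) (x : ℂ) (u : UnitaryMat n) :
    tailSum m N x u = Matrix.trace (polyMat (N + 2) (fun k => tailFactor m N k * x ^ k) u *
      polyMat (N + 1) (fun k => ((1 + m : ℝ)⁻¹ * (m / (1 + m)) ^ k : ℝ) * x ^ k) u) +
      (((m : ℝ) / (1 + m)) ^ (N + 1) : ℝ) * ∑ j ∈ Finset.range (N + 1),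
        tailWeight m j * x ^ (j + (N + 1)) * powTr u (j + (N + 1) : ℕ) := by
  set Y : Matrix (Fin n) (Fin n) ℂ := x • (u : Matrix (Fin n) (Fin n) ℂ) with hY
  set ρ : ℂ := (m : ℂ) / (1 + m) with hρ
  have hm0 : (1 + m : ℂ) ≠ 0 := by
    rw [add_comm]
    exact Nat.cast_add_one_ne_zero m
  have hYk : ∀ k, Y ^ k = x ^ k • (u : Matrix (Fin n) (Fin n) ℂ) ^ k := fun k => smul_pow _ _ _
  set H : Matrix (Fin n) (Fin n) ℂ := ∑ j ∈ Finset.range (N + 1), (tailWeight m j : ℂ) • Y ^ j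
    with hH
  have htrY : ∀ k : ℕ, Matrix.trace (Y ^ k) = x ^ k * powTr u k := fun k => by
    rw [hYk, Matrix.trace_smul, powTr_natCast, smul_eq_mul]
  have e1 : tailSum m N x u = H.trace := by
    rw [hH, Matrix.trace_sum, tailSum]
    refine Finset.sum_congr rfl fun j _ => ?_
    rw [Matrix.trace_smul, htrY, smul_eq_mul, mul_assoc]
  have e2 : polyMat (N + 1) (fun k => ((1 + m : ℝ)⁻¹ * (m / (1 + m)) ^ k : ℝ) * x ^ k) u =
      (1 + m : ℂ)⁻¹ • ∑ k ∈ Finset.range (N + 1), (ρ • Y) ^ k := by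
    rw [polyMat, Finset.smul_sum]
    refine Finset.sum_congr rfl fun k _ => ?_
    rw [smul_pow, hYk, smul_smul, smul_smul, hρ]
    push_cast
    ring_nf
  have e3 : polyMat (N + 2) (fun k => tailFactor m N k * x ^ k) u =
      (1 + m : ℂ) • (H * (1 - ρ • Y)) := by
    have hρ' : (1 + m : ℂ) * ρ = m := by
      rw [hρ]
      field_simp
    have : (1 + m : ℂ) • (H * (1 - ρ • Y)) = (1 + m : ℂ) • H - (m : ℂ) • (H * Y) := by
      rw [mul_sub, mul_one, smul_sub, mul_smul_comm, smul_smul, hρ']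
    rw [this, polyMat]
    have hsum : ∀ k, ((tailFactor m N k : ℂ) * x ^ k) • (u : Matrix (Fin n) (Fin n) ℂ) ^ k =
        (if k < N + 1 then (1 + m : ℂ) * tailWeight m k else 0) • Y ^ k -
          (if k = 0 then 0 else (m : ℂ) * tailWeight m (k - 1)) • Y ^ k := by
      intro k
      rw [mul_smul, ← hYk, ← sub_smul, tailFactor]
      push_cast
      simp only [apply_ite ((↑) : ℝ → ℂ)]
      push_cast
      rfl
    simp only [hsum]
    rw [Finset.sum_sub_distrib]
    congr 1
    · rw [Finset.sum_range_succ, if_neg (lt_irrefl _), zero_smul, add_zero, hH, Finset.smul_sum]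
      refine Finset.sum_congr rfl fun k hk => ?_
      rw [if_pos (Finset.mem_range.mp hk), smul_smul]
    · rw [Finset.sum_range_succ', if_pos rfl, zero_smul, add_zero, hH, Finset.sum_mul,
        Finset.smul_sum]
      refine Finset.sum_congr rfl fun k _ => ?_
      rw [if_neg (Nat.succ_ne_zero k), Nat.add_sub_cancel, smul_mul_assoc, ← pow_succ, smul_smul]
  have e4 : polyMat (N + 2) (fun k => tailFactor m N k * x ^ k) u *
      polyMat (N + 1) (fun k => ((1 + m : ℝ)⁻¹ * (m / (1 + m)) ^ k : ℝ) * x ^ k) u =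
      H - ρ ^ (N + 1) • (H * Y ^ (N + 1)) := by
    rw [e2, e3, smul_mul_smul_comm, mul_inv_cancel₀ hm0, one_smul, mul_assoc, mul_neg_geom_sum,
      mul_sub, mul_one, smul_pow, mul_smul_comm]
  rw [e4, e1, Matrix.trace_sub, Matrix.trace_smul, hH, Finset.sum_mul, Matrix.trace_sum,
    Matrix.trace_sum]
  have e5 : ∀ j, Matrix.trace ((tailWeight m j : ℂ) • Y ^ j * Y ^ (N + 1)) =
      tailWeight m j * x ^ (j + (N + 1)) * powTr u (j + (N + 1) : ℕ) := fun j => by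
    rw [smul_mul_assoc, ← pow_add, Matrix.trace_smul, htrY, smul_eq_mul, mul_assoc]
  simp only [e5, smul_eq_mul]
  rw [hρ]
  push_cast
  ring

variable (μ : Measure (UnitaryMat n)) [IsProbabilityMeasure μ] [μ.IsMulLeftInvariant]

lemma continuous_tailSum (m N : ℕ) (x : ℂ) : Continuous fun u : UnitaryMat n => tailSum m N x u := by
  unfold tailSum
  fun_prop

lemma integral_norm_tailSum_le {m N : ℕ} (hm : 1 ≤ m) (hN : m ^ 2 ≤ N) {x : ℂ} (hx : ‖x‖ ≤ 1) :
    ∫ u, ‖tailSum m N x u‖ ∂μ ≤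
      4 * n / m + n * ((N + 1 : ℕ) * ((m : ℝ) / (1 + m)) ^ (N + 1)) := by
  have hm' : (1 : ℝ) ≤ m := by exact_mod_cast hm
  set c : ℕ → ℂ := fun k => tailFactor m N k * x ^ k with hc
  set d : ℕ → ℂ := fun k => ((1 + m : ℝ)⁻¹ * (m / (1 + m)) ^ k : ℝ) * x ^ k with hd
  have hbase := integral_norm_trace_polyMat_mul_polyMat_le μ (N + 2) (N + 1) c d
  have hxk : ∀ k, (‖x‖ ^ k) ^ 2 ≤ 1 := fun k => pow_le_one₀ (by positivity)
    (pow_le_one₀ (norm_nonneg _) hx)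
  have h1 : ∑ k ∈ Finset.range (N + 2), ‖c k‖ ^ 2 ≤ 6 / m := by
    refine (Finset.sum_le_sum fun k _ => ?_).trans (sum_tailFactor_sq_le hm hN)
    rw [hc, norm_mul, norm_pow, mul_pow, Complex.norm_real, Real.norm_eq_abs, sq_abs]
    exact mul_le_of_le_one_right (sq_nonneg _) (hxk k)
  have h2 : ∑ k ∈ Finset.range (N + 1), ‖d k‖ ^ 2 ≤ 1 / m := by
    refine (Finset.sum_le_sum fun k _ => ?_).trans (sum_geom_sq_le hm (N + 1))
    rw [hd, norm_mul, norm_pow, mul_pow, Complex.norm_real, Real.norm_eq_abs, sq_abs]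
    exact mul_le_of_le_one_right (sq_nonneg _) (hxk k)
  have hcont : Continuous fun u : UnitaryMat n =>
      ‖Matrix.trace (polyMat (N + 2) c u * polyMat (N + 1) d u)‖ :=
    ((continuous_polyMat _ c).matrix_mul (continuous_polyMat _ d)).matrix_trace.norm
  have hint : ∀ f : UnitaryMat n → ℝ, Continuous f → Integrable f μ := fun f hf =>
    hf.integrable_of_hasCompactSupport (HasCompactSupport.of_compactSpace f)
  have hpt : ∀ u : UnitaryMat n, ‖tailSum m N x u‖ ≤
      ‖Matrix.trace (polyMat (N + 2) c u * polyMat (N + 1) d u)‖ +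
        n * ((N + 1 : ℕ) * ((m : ℝ) / (1 + m)) ^ (N + 1)) := by
    intro u
    rw [tailSum_factor]
    refine (norm_add_le _ _).trans (add_le_add le_rfl ?_)
    rw [norm_mul, Complex.norm_real, Real.norm_of_nonneg (by positivity)]
    have : ‖∑ j ∈ Finset.range (N + 1),
        (tailWeight m j : ℂ) * x ^ (j + (N + 1)) * powTr u (j + (N + 1) : ℕ)‖ ≤
        ∑ j ∈ Finset.range (N + 1), (n : ℝ) := by
      refine norm_sum_le_of_le _ fun j _ => ?_
      rw [norm_mul, norm_mul, norm_pow, Complex.norm_real,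
        Real.norm_of_nonneg (tailWeight_nonneg m j)]
      have h3 : tailWeight m j * ‖x‖ ^ (j + (N + 1)) ≤ 1 :=
        mul_le_one₀ (tailWeight_le_one m j) (by positivity) (pow_le_one₀ (norm_nonneg _) hx)
      calc _ ≤ 1 * (n : ℝ) := mul_le_mul h3 (norm_powTr_le u _) (norm_nonneg _) zero_le_one
        _ = n := one_mul _
    rw [Finset.sum_const, Finset.card_range, nsmul_eq_mul] at this
    calc _ ≤ ((m : ℝ) / (1 + m)) ^ (N + 1) * ((N + 1 : ℕ) * n) :=
          mul_le_mul_of_nonneg_left this (by positivity)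
      _ = _ := by ring
  refine (integral_mono (hint _ (continuous_tailSum m N x).norm)
    ((hint _ hcont).add (integrable_const _)) hpt).trans ?_
  simp only [Pi.add_apply]
  rw [integral_add (hint _ hcont) (integrable_const _), integral_const, probReal_univ, one_smul]
  refine add_le_add (hbase.trans ?_) le_rfl
  have h3 : 4 * (n : ℝ) / m = n * (6 / m + 1 / m + 1 / m) / 2 := by
    field_simp
    ring
  rw [h3]
  have h4 : (0 : ℝ) ≤ 1 / m := by positivity
  have h5 : (0 : ℝ) ≤ n := Nat.cast_nonneg n
  gcongr
  linarith

end Tail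

section LogZ

variable {n : ℕ}

/-- The point `e^{-(ε+iφ)}` at which the power series of `log Z` is evaluated. -/
noncomputable def seriesPoint (ε φ : ℝ) : ℂ := Complex.exp (-(ε + φ * Complex.I))

lemma norm_seriesPoint (ε φ : ℝ) : ‖seriesPoint ε φ‖ = Real.exp (-ε) := by
  simp [seriesPoint, Complex.norm_exp]

/-- The terms of the power series of `-log Z`. -/
noncomputable def seriesTerm (x : ℂ) (u : UnitaryMat n) (j : ℕ) : ℂ :=
  powTr u (j + 1 : ℕ) * x ^ (j + 1) / (j + 1)

lemma continuous_seriesTerm (x : ℂ) (j : ℕ) :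
    Continuous fun u : UnitaryMat n => seriesTerm x u j := by
  unfold seriesTerm
  fun_prop

lemma logZser_eq_neg_tsum (u : UnitaryMat n) (ε φ : ℝ) :
    logZser n u ε φ = -∑' j, seriesTerm (seriesPoint ε φ) u j := by
  unfold logZser
  congr 1
  refine tsum_congr fun j => ?_
  rw [seriesTerm, powTr_natCast, seriesPoint, ← Complex.exp_nat_mul]
  congr 3
  push_cast
  ring

lemma summable_seriesTerm {x : ℂ} (hx : ‖x‖ < 1) (u : UnitaryMat n) :
    Summable (seriesTerm x u) := by
  refine Summable.of_norm_bounded (g := fun j => n * ‖x‖ ^ j)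
    ((summable_geometric_of_lt_one (norm_nonneg _) hx).mul_left _) fun j => ?_
  rw [seriesTerm, norm_div, norm_mul, norm_pow]
  have h1 : ‖(j : ℂ) + 1‖ = j + 1 := by
    rw [← Nat.cast_add_one, Complex.norm_natCast, Nat.cast_add_one]
  rw [h1]
  refine (div_le_self (by positivity) (by linarith [(Nat.cast_nonneg j : (0 : ℝ) ≤ j)])).trans ?_
  exact mul_le_mul (norm_powTr_le u _)
    (pow_le_pow_of_le_one (norm_nonneg _) hx.le (Nat.le_succ j)) (by positivity) (by positivity)

lemma tendsto_logZ_of_pos {ε : ℝ} (hε : 0 < ε) (φ : ℝ) (u : UnitaryMat n) :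
    Tendsto (fun N => ∑ j ∈ Finset.range N, seriesTerm (seriesPoint ε φ) u j) atTop
      (𝓝 (-logZ n u ε φ)) := by
  rw [logZ, if_pos hε, logZser_eq_neg_tsum, neg_neg]
  refine (summable_seriesTerm ?_ u).hasSum.tendsto_sum_nat
  rw [norm_seriesPoint]
  exact Real.exp_lt_one_iff.mpr (by linarith)

/-- By Abel's theorem, the radial limit of `log Z` is the sum of its series whenever the latter
converges. -/
lemma tendsto_logZ_zero_of_tendsto {φ : ℝ} {u : UnitaryMat n} {l : ℂ}
    (h : Tendsto (fun N => ∑ j ∈ Finset.range N, seriesTerm (seriesPoint 0 φ) u j) atTop (𝓝 l)) :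
    logZ n u 0 φ = -l := by
  rw [logZ, if_neg (lt_irrefl 0)]
  refine Tendsto.limUnder_eq ?_
  have hr : Tendsto (fun ε : ℝ => Real.exp (-ε)) (𝓝[>] 0) (𝓝[<] 1) := by
    refine tendsto_nhdsWithin_iff.mpr ⟨?_, ?_⟩
    · have : Tendsto (fun ε : ℝ => Real.exp (-ε)) (𝓝 0) (𝓝 (Real.exp (-0))) :=
        (Real.continuous_exp.comp continuous_neg).tendsto 0
      rw [neg_zero, Real.exp_zero] at this
      exact this.mono_left nhdsWithin_le_nhds
    · filter_upwards [self_mem_nhdsWithin] with ε hε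
      exact Real.exp_lt_one_iff.mpr (by simpa using hε)
  have hr' : Tendsto (fun ε : ℝ => ((Real.exp (-ε) : ℝ) : ℂ)) (𝓝[>] 0) (𝓝 1) := by
    have := (Complex.continuous_ofReal.tendsto 1).comp (hr.mono_right nhdsWithin_le_nhds)
    simpa [Function.comp_def] using this
  have hA := (Complex.tendsto_tsum_powerSeries_nhdsWithin_lt h).comp
    (tendsto_map.comp hr)
  have := (hr'.mul hA).neg
  rw [one_mul] at this
  refine this.congr fun ε => ?_
  rw [logZser_eq_neg_tsum, Function.comp_apply, Function.comp_apply, ← tsum_mul_left]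
  congr 1
  refine tsum_congr fun j => ?_
  have hx : seriesPoint ε φ = ((Real.exp (-ε) : ℝ) : ℂ) * seriesPoint 0 φ := by
    rw [seriesPoint, seriesPoint, Complex.ofReal_exp, ← Complex.exp_add]
    congr 1
    push_cast
    ring
  rw [seriesTerm, seriesTerm, hx, mul_pow]
  ring

lemma exists_tendsto_sum_seriesTerm {φ : ℝ} {u : UnitaryMat n}
    (hu : IsUnit (1 - seriesPoint 0 φ • (u : Matrix (Fin n) (Fin n) ℂ))) :
    ∃ l, Tendsto (fun N => ∑ j ∈ Finset.range N, seriesTerm (seriesPoint 0 φ) u j) atTop (𝓝 l) := by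
  set Y : UnitaryMat n := scalarUnitary n (-φ) * u with hY
  have hYv : (Y : Matrix (Fin n) (Fin n) ℂ) = seriesPoint 0 φ • (u : Matrix (Fin n) (Fin n) ℂ) := by
    rw [hY, scalarUnitary_mul_val, seriesPoint]
    congr 2
    push_cast
    ring
  rw [← hYv] at hu
  obtain ⟨R, hR⟩ := hu.exists_left_inv
  obtain ⟨b, hb⟩ := isCompact_univ.exists_bound_of_continuousOn
    (f := fun V : UnitaryMat n => Matrix.trace ((Y : Matrix (Fin n) (Fin n) ℂ) * (R * (1 - (V : Matrix (Fin n) (Fin n) ℂ)))))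
    (Continuous.continuousOn (by fun_prop))
  have hterm : ∀ j : ℕ, powTr Y (j + 1 : ℕ) = powTr u (j + 1 : ℕ) * seriesPoint 0 φ ^ (j + 1) :=
    fun j => by
      rw [powTr_natCast, powTr_natCast, hYv, smul_pow, Matrix.trace_smul, smul_eq_mul, mul_comm]
  have hbd : ∀ N, ‖∑ j ∈ Finset.range N, powTr Y (j + 1 : ℕ)‖ ≤ b := fun N => by
    have h1 : ∑ j ∈ Finset.range N, powTr Y (j + 1 : ℕ) =
        Matrix.trace ((Y : Matrix (Fin n) (Fin n) ℂ) *
          (R * (1 - ((Y ^ N : UnitaryMat n) : Matrix (Fin n) (Fin n) ℂ)))) := by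
      have h2 : R * (1 - ((Y ^ N : UnitaryMat n) : Matrix (Fin n) (Fin n) ℂ)) =
          ∑ j ∈ Finset.range N, (Y : Matrix (Fin n) (Fin n) ℂ) ^ j := by
        rw [SubmonoidClass.coe_pow, ← mul_neg_geom_sum, ← mul_assoc, hR, one_mul]
      rw [h2, Finset.mul_sum, Matrix.trace_sum]
      refine Finset.sum_congr rfl fun j _ => ?_
      rw [powTr_natCast, pow_succ']
    rw [h1]
    exact hb _ (Set.mem_univ _)
  have hanti : Antitone fun j : ℕ => 1 / ((j : ℝ) + 1) := fun i j hij => by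
    have : (i : ℝ) ≤ j := by exact_mod_cast hij
    exact one_div_le_one_div_of_le (by positivity) (by linarith)
  have := hanti.cauchySeq_series_mul_of_tendsto_zero_of_bounded
    tendsto_one_div_add_atTop_nhds_zero_nat hbd
  obtain ⟨l, hl⟩ := cauchySeq_tendsto_of_complete this
  refine ⟨l, hl.congr fun N => Finset.sum_congr rfl fun j _ => ?_⟩
  rw [seriesTerm, ← hterm, Complex.real_smul]
  push_cast
  ring

lemma eventually_isUnit_one_sub_smul (u : UnitaryMat n) {z : ℕ → ℂ} (hz : Function.Injective z) :
    ∀ᶠ k in atTop, IsUnit (1 - z k • (u : Matrix (Fin n) (Fin n) ℂ)) := by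
  have hne : Matrix.charpolyRev (u : Matrix (Fin n) (Fin n) ℂ) ≠ 0 := fun h => by
    have := Matrix.eval_charpolyRev (M := (u : Matrix (Fin n) (Fin n) ℂ))
    simp [h] at this
  have hfin := (Polynomial.finite_setOfPred_isRoot hne).preimage hz.injOn
  have := hfin.eventually_cofinite_notMem
  rw [Nat.cofinite_eq_atTop] at this
  filter_upwards [this] with k hk
  rw [Matrix.isUnit_iff_isUnit_det, isUnit_iff_ne_zero]
  intro h0
  refine hk ?_
  change Polynomial.eval (z k) (Matrix.charpolyRev (u : Matrix (Fin n) (Fin n) ℂ)) = 0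
  rw [Matrix.charpolyRev, ← Polynomial.coe_evalRingHom, RingHom.map_det, ← h0]
  congr 1
  ext i j
  simp only [RingHom.mapMatrix_apply, Matrix.map_apply, Matrix.sub_apply, Matrix.one_apply,
    Matrix.smul_apply, smul_eq_mul, Polynomial.coe_evalRingHom]
  split_ifs <;> simp <;> exact mul_comm _ _

variable (μ : Measure (UnitaryMat n)) [IsProbabilityMeasure μ] [μ.IsMulLeftInvariant]

lemma ae_isUnit_one_sub_smul (φ : ℝ) :
    ∀ᵐ u : UnitaryMat n ∂μ, IsUnit (1 - seriesPoint 0 φ • (u : Matrix (Fin n) (Fin n) ℂ)) := by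
  set S : Set (UnitaryMat n) :=
    {u | ¬ IsUnit (1 - seriesPoint 0 φ • (u : Matrix (Fin n) (Fin n) ℂ))} with hS
  set θ : ℕ → ℝ := fun k => 1 / ((k : ℝ) + 1) with hθ
  have hθpos : ∀ k, 0 < θ k := fun k => by positivity
  have hθle : ∀ k, θ k ≤ 1 := fun k => by
    rw [hθ, div_le_one (by positivity)]
    linarith [(Nat.cast_nonneg k : (0 : ℝ) ≤ k)]
  have hinj : Function.Injective fun k => seriesPoint 0 φ * Complex.exp (θ k * Complex.I) := by
    intro k l hkl
    have h1 := mul_left_cancel₀ (Complex.exp_ne_zero _) hkl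
    have hpi := Real.pi_gt_three
    have h2 := Complex.exp_inj_of_neg_pi_lt_of_le_pi
      (by simp; linarith [hθpos k]) (by simp; linarith [hθle k])
      (by simp; linarith [hθpos l]) (by simp; linarith [hθle l]) h1
    have h3 : θ k = θ l := by simpa using h2
    have h4 : (k : ℝ) + 1 = l + 1 := by simpa [hθ] using h3
    exact_mod_cast add_right_cancel h4
  have hmeas : MeasurableSet S := by
    have : S = {u : UnitaryMat n | Matrix.det (1 - seriesPoint 0 φ • (u : Matrix (Fin n) (Fin n) ℂ)) = 0} := by
      ext u
      simp only [hS, Set.mem_ofPred_eq, Matrix.isUnit_iff_isUnit_det, isUnit_iff_ne_zero, not_not]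
    rw [this]
    exact (isClosed_eq (Continuous.matrix_det (by fun_prop)) continuous_const).measurableSet
  have hpre : ∀ k, μ ((fun u => scalarUnitary n (θ k) * u) ⁻¹' S) = μ S := fun k =>
    measure_preimage_mul μ _ S
  have hlim := tendsto_measure_of_tendsto_indicator (A := (∅ : Set (UnitaryMat n))) atTop (μ := μ)
    (As := fun k => (fun u => scalarUnitary n (θ k) * u) ⁻¹' S)
    (fun k => (measurable_const_mul _) hmeas) MeasurableSet.univ (measure_ne_top _ _)
    (Eventually.of_forall fun _ => Set.subset_univ _) (fun u => by
      filter_upwards [eventually_isUnit_one_sub_smul u hinj] with k hk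
      simp only [Set.mem_preimage, Set.mem_empty_iff_false, iff_false, hS, Set.mem_ofPred_eq,
        not_not]
      rw [scalarUnitary_mul_val, smul_smul]
      exact hk)
  simp only [hpre, measure_empty] at hlim
  exact tendsto_nhds_unique tendsto_const_nhds hlim

lemma ae_tendsto_logZ {ε : ℝ} (hε : 0 ≤ ε) (φ : ℝ) :
    ∀ᵐ u ∂μ, Tendsto (fun N => ∑ j ∈ Finset.range N, seriesTerm (seriesPoint ε φ) u j) atTop
      (𝓝 (-logZ n u ε φ)) := by
  rcases hε.eq_or_lt with rfl | hε
  · filter_upwards [ae_isUnit_one_sub_smul μ φ] with u hu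
    obtain ⟨l, hl⟩ := exists_tendsto_sum_seriesTerm hu
    rwa [tendsto_logZ_zero_of_tendsto hl, neg_neg]
  · exact Eventually.of_forall fun u => tendsto_logZ_of_pos hε φ u

lemma aemeasurable_logZ {ε : ℝ} (hε : 0 ≤ ε) (φ : ℝ) :
    AEMeasurable (fun u => logZ n u ε φ) μ := by
  have : AEMeasurable (fun u => -logZ n u ε φ) μ :=
    aemeasurable_of_tendsto_metrizable_ae atTop (fun N =>
      (continuous_finsetSum _ fun j _ => continuous_seriesTerm _ j).measurable.aemeasurable)
      (ae_tendsto_logZ μ hε φ)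
  simpa only [Pi.neg_def, neg_neg] using this.neg

/-- The coefficients of the smoothly truncated series of `-log Z`. -/
noncomputable def truncCoeff (m : ℕ) (x : ℂ) (j : ℕ) : ℂ := ((1 / j - tailWeight m j : ℝ) : ℂ) * x ^ j

lemma tailSum_add_linStat {m N : ℕ} (hm : 1 ≤ m) (hmN : m ≤ N) (x : ℂ) (u : UnitaryMat n) :
    tailSum m N x u + linStat m (truncCoeff m x) u = ∑ j ∈ Finset.range N, seriesTerm x u j := by
  have h1 : linStat m (truncCoeff m x) u =
      ∑ j ∈ Finset.range (N + 1), truncCoeff m x j * powTr u j := by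
    rw [linStat, Finset.range_eq_Ico]
    refine Finset.sum_subset (Finset.Ico_subset_Ico (Nat.zero_le _) (by omega)) fun j _ hj => ?_
    rw [Finset.mem_Ico, not_and_or] at hj
    rcases hj with hj | hj
    · obtain rfl : j = 0 := by omega
      simp [truncCoeff, tailWeight_zero]
    · rw [truncCoeff, tailWeight_of_ge hm (by omega)]
      simp
  rw [h1, tailSum, ← Finset.sum_add_distrib, Finset.sum_range_succ']
  simp only [truncCoeff, tailWeight_zero]
  simp only [CharP.cast_eq_zero, div_zero, sub_zero, Complex.ofReal_zero, zero_mul, add_zero]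
  refine Finset.sum_congr rfl fun j _ => ?_
  rw [seriesTerm]
  push_cast
  ring

lemma lintegral_logZ_add_linStat_le {m : ℕ} (hm : 1 ≤ m) {ε : ℝ} (hε : 0 ≤ ε) (φ : ℝ) :
    ∫⁻ u, ‖logZ n u ε φ + linStat m (truncCoeff m (seriesPoint ε φ)) u‖ₑ ∂μ ≤
      ENNReal.ofReal (4 * n / m) := by
  set x := seriesPoint ε φ with hx
  have hx1 : ‖x‖ ≤ 1 := by
    rw [hx, norm_seriesPoint]
    exact Real.exp_le_one_iff.mpr (by linarith)
  set F : ℕ → UnitaryMat n → ℂ := fun N u => tailSum m N x u with hF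
  have hlim : ∀ᵐ u ∂μ, ‖logZ n u ε φ + linStat m (truncCoeff m x) u‖ₑ =
      liminf (fun N => ‖F N u‖ₑ) atTop := by
    filter_upwards [ae_tendsto_logZ μ hε φ] with u hu
    have h1 : Tendsto (fun N => F N u) atTop
        (𝓝 (-logZ n u ε φ - linStat m (truncCoeff m x) u)) := by
      refine (hu.sub_const (linStat m (truncCoeff m x) u)).congr' ?_
      filter_upwards [eventually_ge_atTop m] with N hN
      rw [← tailSum_add_linStat hm hN, add_sub_cancel_right]
    rw [h1.enorm.liminf_eq, ← enorm_neg, neg_add, sub_eq_add_neg]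
  rw [lintegral_congr_ae hlim]
  refine (lintegral_liminf_le fun N => (continuous_tailSum m N x).enorm.measurable).trans ?_
  have hbd : ∀ᶠ N in atTop, ∫⁻ u, ‖F N u‖ₑ ∂μ ≤
      ENNReal.ofReal (4 * n / m + n * ((N + 1 : ℕ) * ((m : ℝ) / (1 + m)) ^ (N + 1))) := by
    filter_upwards [eventually_ge_atTop (m ^ 2)] with N hN
    have hi : Integrable (fun u => F N u) μ := integrable_of_continuous (continuous_tailSum m N x)
    rw [← ofReal_integral_norm_eq_lintegral_enorm hi]
    exact ENNReal.ofReal_le_ofReal (integral_norm_tailSum_le μ hm hN hx1)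
  have hm' : (1 : ℝ) ≤ m := by exact_mod_cast hm
  have h0 : Tendsto (fun N : ℕ => ENNReal.ofReal
      (4 * n / m + n * ((N + 1 : ℕ) * ((m : ℝ) / (1 + m)) ^ (N + 1)))) atTop
      (𝓝 (ENNReal.ofReal (4 * n / m))) := by
    refine ENNReal.tendsto_ofReal ?_
    have h1 := (tendsto_self_mul_const_pow_of_lt_one (r := (m : ℝ) / (1 + m)) (by positivity)
      ((div_lt_one (by positivity)).mpr (by linarith))).comp (tendsto_add_atTop_nat 1)
    simpa [Function.comp_def] using (h1.const_mul (n : ℝ)).const_add (4 * (n : ℝ) / m)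
  rw [← h0.liminf_eq]
  exact liminf_le_liminf hbd

end LogZ

section Covariance

/-- The weights in the covariance of the truncated series. -/
noncomputable def covWeight (m j : ℕ) : ℝ := j * (1 / j - tailWeight m j) ^ 2

/-- The covariance of two truncated series. -/
noncomputable def covKernel (m : ℕ) (z : ℂ) : ℂ :=
  ∑ j ∈ Finset.Ico 1 (m + 1), (covWeight m j : ℂ) * z ^ j

lemma abs_covWeight_mul_pow_sub_le {m j : ℕ} (hj : 1 ≤ j) (hjm : j ≤ m) {s : ℝ} (hs0 : 0 ≤ s)
    (hs1 : s ≤ 1) :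
    |covWeight m j * s ^ j - (1 - 1 / (m : ℝ)) ^ j / j| ≤ 3 / m + (1 - s) := by
  have hj' : (1 : ℝ) ≤ j := by exact_mod_cast hj
  have hjm' : (j : ℝ) ≤ m := by exact_mod_cast hjm
  have hm' : (1 : ℝ) ≤ m := hj'.trans hjm'
  rw [covWeight, tailWeight_of_le (hj.trans hjm) hjm]
  have hr0 : 0 ≤ 1 - 1 / (m : ℝ) := by
    rw [sub_nonneg, div_le_one (by positivity)]
    exact hm'
  have hr1 : 1 - 1 / (m : ℝ) ≤ 1 := sub_le_self _ (by positivity)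
  have hb1 := one_add_mul_le_pow (a := s - 1) (by linarith) j
  have hb2 := one_add_mul_le_pow (a := 1 - 1 / (m : ℝ) - 1) (by linarith) j
  rw [add_sub_cancel] at hb1 hb2
  have hsj1 : s ^ j ≤ 1 := pow_le_one₀ hs0 hs1
  have hsj0 : 0 ≤ s ^ j := by positivity
  have hrj1 : (1 - 1 / (m : ℝ)) ^ j ≤ 1 := pow_le_one₀ hr0 hr1
  set p := s ^ j
  set q := (1 - 1 / (m : ℝ)) ^ j
  set y : ℝ := (j : ℝ) / m with hy
  have hy0 : 0 ≤ y := by positivity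
  have hy1 : y ≤ 1 := (div_le_one (by positivity)).mpr hjm'
  have e1 : (j : ℝ) * (1 / j - j / (m : ℝ) ^ 2) ^ 2 * p - q / j =
      (1 / j) * ((1 - y ^ 2) ^ 2 * p - q) := by
    rw [hy]
    field_simp
  have hq : 1 - q ≤ y := by
    rw [hy]
    have : (j : ℝ) * (1 - 1 / m - 1) = -(j / m) := by ring
    linarith
  have hy2 : y ^ 2 ≤ y := by nlinarith
  have hlow : (1 - y ^ 2) ^ 2 * p - q ≥ -(2 * y + j * (1 - s)) := by
    nlinarith [mul_nonneg (sq_nonneg (y ^ 2)) hsj0, mul_nonneg (sq_nonneg y) (sub_nonneg.mpr hsj1)]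
  have hup : (1 - y ^ 2) ^ 2 * p - q ≤ y := by
    have : (1 - y ^ 2) ^ 2 * p ≤ 1 := by
      have h1 : (1 - y ^ 2) ^ 2 ≤ 1 := by nlinarith [sq_nonneg y]
      exact mul_le_one₀ h1 hsj0 hsj1
    linarith
  have hjs : 0 ≤ (j : ℝ) * (1 - s) := mul_nonneg (by linarith) (by linarith)
  rw [e1, abs_mul, abs_of_nonneg (by positivity)]
  have habs : |(1 - y ^ 2) ^ 2 * p - q| ≤ 3 * y + j * (1 - s) := by
    rw [abs_le]
    constructor <;> linarith
  calc _ ≤ 1 / (j : ℝ) * (3 * y + j * (1 - s)) := mul_le_mul_of_nonneg_left habs (by positivity)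
    _ = _ := by
      rw [hy]
      field_simp

lemma norm_covKernel_add_log_le {m : ℕ} (hm : 1 ≤ m) {s : ℝ} (hs0 : 0 ≤ s) (hs1 : s ≤ 1) {e : ℂ}
    (he : ‖e‖ = 1) :
    ‖covKernel m (s * e) + Complex.log (1 - ((1 - 1 / (m : ℝ) : ℝ) : ℂ) * e)‖ ≤
      4 + m * (1 - s) := by
  have hm' : (1 : ℝ) ≤ m := by exact_mod_cast hm
  set r : ℝ := 1 - 1 / (m : ℝ) with hr
  have hr0 : 0 ≤ r := by
    rw [hr, sub_nonneg, div_le_one (by positivity)]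
    exact hm'
  have hr1 : r < 1 := sub_lt_self _ (by positivity)
  have hre : ‖(r : ℂ) * e‖ < 1 := by
    rwa [norm_mul, he, mul_one, Complex.norm_real, Real.norm_of_nonneg hr0]
  have h1 := Complex.hasSum_taylorSeries_neg_log hre
  have h2 : HasSum (fun j : ℕ => if j ∈ Finset.Ico 1 (m + 1) then
      (covWeight m j : ℂ) * (s * e) ^ j else 0) (covKernel m (s * e)) := by
    have := hasSum_sum_of_ne_finset_zero (L := .unconditional ℕ) (s := Finset.Ico 1 (m + 1)) (f := fun j : ℕ =>
      if j ∈ Finset.Ico 1 (m + 1) then (covWeight m j : ℂ) * (s * e) ^ j else 0)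
      (fun j hj => if_neg hj)
    rwa [Finset.sum_congr rfl fun j hj => if_pos hj] at this
  have h3 := h2.sub h1
  rw [sub_neg_eq_add] at h3
  have h4 : HasSum (fun j : ℕ => (if j ∈ Finset.Ico 1 (m + 1) then 3 / (m : ℝ) + (1 - s) else 0) +
      1 / m * r ^ j) (m * (3 / (m : ℝ) + (1 - s)) + 1 / m * (1 - r)⁻¹) := by
    refine HasSum.add ?_ ((hasSum_geometric_of_lt_one hr0 hr1).mul_left _)
    have := hasSum_sum_of_ne_finset_zero (L := .unconditional ℕ) (s := Finset.Ico 1 (m + 1)) (f := fun j : ℕ =>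
      if j ∈ Finset.Ico 1 (m + 1) then 3 / (m : ℝ) + (1 - s) else 0) (fun j hj => if_neg hj)
    rw [Finset.sum_congr rfl fun j hj => if_pos hj, Finset.sum_const, Nat.card_Ico,
      nsmul_eq_mul, Nat.add_sub_cancel] at this
    exact this
  have h5 := tsum_of_norm_bounded h4 (f := fun j : ℕ => (if j ∈ Finset.Ico 1 (m + 1) then
      (covWeight m j : ℂ) * (s * e) ^ j else 0) - (r * e) ^ j / j) (fun j => ?_)
  · rw [h3.tsum_eq] at h5
    refine h5.trans (le_of_eq ?_)
    rw [hr]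
    field_simp
    ring
  · split_ifs with hj
    · rw [Finset.mem_Ico] at hj
      have e1 : (covWeight m j : ℂ) * (s * e) ^ j - (r * e) ^ j / j =
          ((covWeight m j * s ^ j - r ^ j / j : ℝ) : ℂ) * e ^ j := by
        push_cast
        ring
      rw [e1, norm_mul, norm_pow, he, one_pow, mul_one, Complex.norm_real, Real.norm_eq_abs]
      refine (abs_covWeight_mul_pow_sub_le hj.1 (by omega) hs0 hs1).trans ?_
      exact le_add_of_nonneg_right (by positivity)
    · rw [zero_sub, norm_neg, norm_div, norm_pow, norm_mul, he, mul_one, Complex.norm_real,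
        Real.norm_of_nonneg hr0, Complex.norm_natCast, zero_add]
      rcases Nat.eq_zero_or_pos j with rfl | hj0
      · simp
      · have hjm : m ≤ j := by
          rw [Finset.mem_Ico] at hj
          omega
        have hjm' : (m : ℝ) ≤ j := by exact_mod_cast hjm
        rw [div_eq_mul_one_div, mul_comm]
        gcongr

lemma le_sin_of_le_pi_sub {δ t : ℝ} (hδ : 0 < δ) (ht0 : 0 ≤ t) (ht : t ≤ Real.pi - δ) :
    min (2 / Real.pi) (2 * δ / Real.pi ^ 2) * t ≤ Real.sin t := by
  have hpi := Real.pi_pos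
  rcases le_total t (Real.pi / 2) with h | h
  · exact (mul_le_mul_of_nonneg_right (min_le_left _ _) ht0).trans (Real.mul_le_sin ht0 h)
  · refine (mul_le_mul_of_nonneg_right (min_le_right _ _) ht0).trans ?_
    have h1 := Real.mul_le_sin (x := Real.pi - t) (by linarith) (by linarith)
    rw [Real.sin_pi_sub] at h1
    refine le_trans ?_ h1
    have h2 : 2 * δ / Real.pi ^ 2 * t = 2 / Real.pi * (δ * (t / Real.pi)) := by
      field_simp
    rw [h2]
    refine mul_le_mul_of_nonneg_left ?_ (by positivity)
    have h3 : t / Real.pi ≤ 1 := (div_le_one hpi).mpr (by linarith)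
    nlinarith

lemma exists_mul_abs_le_norm_one_sub {δ : ℝ} (hδ : 0 < δ) : ∃ κ : ℝ, 0 < κ ∧ κ ≤ 1 ∧
    ∀ r Δ : ℝ, 1 / 2 ≤ r → |Δ| ≤ 2 * Real.pi - δ →
      κ * |Δ| ≤ ‖1 - (r : ℂ) * Complex.exp (Δ * Complex.I)‖ := by
  have hpi := Real.pi_pos
  set κ := min (2 / Real.pi) (2 * (δ / 2) / Real.pi ^ 2) with hκ
  have hκ0 : 0 < κ := lt_min (by positivity) (by positivity)
  have hκ1 : κ ≤ 1 := (min_le_left _ _).trans ((div_le_one hpi).mpr Real.two_le_pi)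
  refine ⟨κ / 2, by positivity, by linarith, fun r Δ hr hΔ => ?_⟩
  have h1 := le_sin_of_le_pi_sub (t := |Δ| / 2) (half_pos hδ) (by positivity) (by linarith)
  rw [← hκ] at h1
  have h2 : ‖1 - (r : ℂ) * Complex.exp (Δ * Complex.I)‖ ^ 2 =
      (1 - r) ^ 2 + 4 * r * Real.sin (|Δ| / 2) ^ 2 := by
    rw [Complex.exp_mul_I, ← Complex.ofReal_cos, ← Complex.ofReal_sin, ← Complex.normSq_eq_norm_sq,
      Complex.normSq_apply]
    have hc : Real.cos Δ = 1 - 2 * Real.sin (|Δ| / 2) ^ 2 := by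
      rw [← Real.cos_abs, ← Real.cos_sq_add_sin_sq (|Δ| / 2)]
      have := Real.cos_two_mul (|Δ| / 2)
      have h3 := Real.cos_sq_add_sin_sq (|Δ| / 2)
      rw [mul_div_cancel₀ _ two_ne_zero] at this
      rw [this]
      linarith
    have hs := Real.sin_sq_add_cos_sq Δ
    simp only [Complex.sub_re, Complex.one_re, Complex.mul_re, Complex.ofReal_re, Complex.add_re,
      Complex.I_re, Complex.ofReal_im, Complex.I_im, Complex.add_im, Complex.mul_im, Complex.sub_im,
      Complex.one_im]
    rw [hc] at hs ⊢
    linear_combination r ^ 2 * hs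
  refine abs_le_of_sq_le_sq' ?_ (norm_nonneg _) |>.2
  rw [h2]
  have h4 : 0 ≤ κ * (|Δ| / 2) := by positivity
  have h5 : (κ * (|Δ| / 2)) ^ 2 ≤ Real.sin (|Δ| / 2) ^ 2 := pow_le_pow_left₀ h4 h1 2
  nlinarith [sq_nonneg (1 - r), sq_nonneg (Real.sin (|Δ| / 2))]

/-- Comparison of the covariance of two truncated series with the logarithm of the distance of the
two points, the distance being cut off at `1 / m`. -/
lemma exists_norm_covKernel_add_log_max_le {δ : ℝ} (hδ : 0 < δ) : ∃ C : ℝ, ∀ (m : ℕ) (s Δ : ℝ),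
    2 ≤ m → 0 ≤ s → s ≤ 1 → |Δ| ≤ 2 * Real.pi - δ →
    ‖covKernel m (s * Complex.exp (Δ * Complex.I)) + (Real.log (max (1 / m) |Δ|) : ℝ)‖ ≤
      C + m * (1 - s) := by
  obtain ⟨κ, hκ0, hκ1, hκ⟩ := exists_mul_abs_le_norm_one_sub hδ
  refine ⟨4 + Real.pi + (Real.log 2 - Real.log κ), fun m s Δ hm hs0 hs1 hΔ => ?_⟩
  have hm' : (2 : ℝ) ≤ m := by exact_mod_cast hm
  set e := Complex.exp (Δ * Complex.I) with he
  have hen : ‖e‖ = 1 := Complex.norm_exp_ofReal_mul_I Δ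
  set r : ℝ := 1 - 1 / (m : ℝ) with hr
  have hm1 : 1 / (m : ℝ) ≤ 1 / 2 := one_div_le_one_div_of_le two_pos hm'
  have hm0 : 0 < 1 / (m : ℝ) := by positivity
  have hr2 : 1 / 2 ≤ r := by linarith
  set D := max (1 / (m : ℝ)) |Δ| with hD
  have hD0 : 0 < D := lt_max_of_lt_left hm0
  set w : ℂ := 1 - (r : ℂ) * e with hw
  have hw1 : κ * D ≤ ‖w‖ := by
    rcases max_choice (1 / (m : ℝ)) |Δ| with h | h
    · rw [hD, h]
      have : 1 - ‖(r : ℂ) * e‖ ≤ ‖w‖ := by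
        simpa using norm_sub_norm_le (1 : ℂ) ((r : ℂ) * e)
      rw [norm_mul, hen, mul_one, Complex.norm_real, Real.norm_of_nonneg (by linarith)] at this
      have h2 : κ * (1 / (m : ℝ)) ≤ 1 / m := mul_le_of_le_one_left hm0.le hκ1
      linarith
    · rw [hD, h]
      exact hκ r Δ hr2 hΔ
  have hw2 : ‖w‖ ≤ 2 * D := by
    have e1 : w = ((1 / (m : ℝ) : ℝ) : ℂ) - (r : ℂ) * (e - 1) := by
      rw [hw, hr]
      push_cast
      ring
    have h1 : ‖e - 1‖ ≤ |Δ| := by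
      have := Real.norm_exp_I_mul_ofReal_sub_one_le (x := Δ)
      rwa [mul_comm, Real.norm_eq_abs] at this
    rw [e1]
    refine (norm_sub_le _ _).trans ?_
    rw [norm_mul, Complex.norm_real, Complex.norm_real, Real.norm_of_nonneg hm0.le,
      Real.norm_of_nonneg (by linarith : (0 : ℝ) ≤ r)]
    have h2 : r * ‖e - 1‖ ≤ 1 * |Δ| :=
      mul_le_mul (by linarith) h1 (norm_nonneg _) zero_le_one
    linarith [le_max_left (1 / (m : ℝ)) |Δ|, le_max_right (1 / (m : ℝ)) |Δ|]
  have hwpos : 0 < ‖w‖ := (mul_pos hκ0 hD0).trans_le hw1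
  have hl1 : Real.log κ + Real.log D ≤ Real.log ‖w‖ := by
    rw [← Real.log_mul hκ0.ne' hD0.ne']
    exact Real.log_le_log (mul_pos hκ0 hD0) hw1
  have hl2 : Real.log ‖w‖ ≤ Real.log 2 + Real.log D := by
    rw [← Real.log_mul two_ne_zero hD0.ne']
    exact Real.log_le_log hwpos hw2
  have hlκ : Real.log κ ≤ 0 := Real.log_nonpos hκ0.le hκ1
  have hl3 : 0 ≤ Real.log 2 := Real.log_nonneg one_le_two
  have hbase := norm_covKernel_add_log_le (by omega : 1 ≤ m) hs0 hs1 hen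
  rw [← hr, ← hw] at hbase
  have e2 : covKernel m (s * e) + (Real.log D : ℝ) = (covKernel m (s * e) + Complex.log w) +
      (((Real.log D - Real.log ‖w‖ : ℝ) : ℂ) - ((Complex.arg w : ℝ) : ℂ) * Complex.I) := by
    rw [Complex.log]
    push_cast
    ring
  have h6 : ‖((Real.log D - Real.log ‖w‖ : ℝ) : ℂ)‖ ≤ Real.log 2 - Real.log κ := by
    rw [Complex.norm_real, Real.norm_eq_abs, abs_le]
    constructor <;> linarith
  have h7 : ‖((Complex.arg w : ℝ) : ℂ) * Complex.I‖ ≤ Real.pi := by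
    rw [norm_mul, Complex.norm_I, mul_one, Complex.norm_real, Real.norm_eq_abs]
    exact Complex.abs_arg_le_pi w
  rw [e2]
  refine (norm_add_le _ _).trans ?_
  have h8 := norm_sub_le (((Real.log D - Real.log ‖w‖ : ℝ) : ℂ))
    (((Complex.arg w : ℝ) : ℂ) * Complex.I)
  linarith

end Covariance

section CovarianceLimit

lemma tendsto_min_toReal {f g : ℕ → ℝ} {c : ℝ≥0∞} (hf : Tendsto f atTop (𝓝 1))
    (hg : Tendsto (fun n => (g n : EReal)) atTop (𝓝 (c : EReal))) :
    Tendsto (fun n => min (g n) (f n)) atTop (𝓝 (min c 1).toReal) := by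
  rw [← EReal.tendsto_coe]
  have h1 : (((min c 1).toReal : ℝ) : EReal) = min (c : EReal) ((1 : ℝ) : EReal) := by
    rw [EReal.coe_ennreal_toReal (min_lt_of_right_lt ENNReal.one_lt_top).ne, EReal.coe_one,
      ← EReal.coe_ennreal_one]
    exact EReal.coe_ennreal_strictMono.monotone.map_min
  rw [h1]
  refine (hg.min (EReal.tendsto_coe.mpr hf)).congr fun n => ?_
  exact (EReal.coe_strictMono.monotone.map_min).symm

lemma neg_log_max_inv {m Δ : ℝ} (hm : 0 < m) (hΔ : Δ ≠ 0) :
    -Real.log (max (1 / m) |Δ|) = min (-Real.log |Δ|) (Real.log m) := by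
  have h1 : Real.log (1 / m) = -Real.log m := by rw [one_div, Real.log_inv]
  have hΔ' := abs_pos.mpr hΔ
  rcases le_total (1 / m) |Δ| with h | h
  · have h2 := Real.log_le_log (by positivity) h
    rw [max_eq_right h, min_eq_left (by linarith)]
  · have h2 := Real.log_le_log hΔ' h
    rw [max_eq_left h, min_eq_right (by linarith), h1, neg_neg]

lemma tendsto_natCast_log_atTop : Tendsto (fun n : ℕ => Real.log n) atTop atTop :=
  Real.tendsto_log_atTop.comp tendsto_natCast_atTop_atTop

lemma tendsto_covKernel_of_tendsto_log_max {m : ℕ → ℕ} {s Δ : ℕ → ℝ} {B δ c : ℝ} (hδ : 0 < δ)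
    (hm : ∀ᶠ n in atTop, 2 ≤ m n) (hs0 : ∀ n, 0 ≤ s n) (hs1 : ∀ n, s n ≤ 1)
    (hB : ∀ᶠ n in atTop, m n * (1 - s n) ≤ B) (hΔ : ∀ n, |Δ n| ≤ 2 * Real.pi - δ)
    (hlim : Tendsto (fun n : ℕ => -Real.log (max (1 / m n) |Δ n|) / Real.log n) atTop (𝓝 c)) :
    Tendsto (fun n : ℕ => covKernel (m n) (s n * Complex.exp (Δ n * Complex.I)) / Real.log n) atTop
      (𝓝 c) := by
  obtain ⟨C, hC⟩ := exists_norm_covKernel_add_log_max_le hδ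
  have h1 : Tendsto (fun n : ℕ => (covKernel (m n) (s n * Complex.exp (Δ n * Complex.I)) +
      (Real.log (max (1 / m n) |Δ n|) : ℝ)) / Real.log n) atTop (𝓝 0) := by
    refine squeeze_zero_norm' ?_ (tendsto_natCast_log_atTop.const_div_atTop (C + B))
    filter_upwards [hm, hB, tendsto_natCast_log_atTop.eventually_gt_atTop 0] with n hmn hBn hn
    rw [norm_div, Complex.norm_real, Real.norm_of_nonneg hn.le]
    have := hC (m n) (s n) (Δ n) hmn (hs0 n) (hs1 n) (hΔ n)
    gcongr
    linarith
  have h2 := h1.add ((Complex.continuous_ofReal.tendsto c).comp hlim)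
  rw [zero_add] at h2
  refine h2.congr fun n => ?_
  simp only [Function.comp_apply]
  push_cast
  ring

lemma tendsto_covKernel {m : ℕ → ℕ} {s Δ : ℕ → ℝ} {B δ : ℝ} {c : ℝ≥0∞} (hδ : 0 < δ)
    (hm : ∀ᶠ n in atTop, 2 ≤ m n)
    (hmlog : Tendsto (fun n : ℕ => Real.log (m n) / Real.log n) atTop (𝓝 1))
    (hs0 : ∀ n, 0 ≤ s n) (hs1 : ∀ n, s n ≤ 1)
    (hB : ∀ᶠ n in atTop, m n * (1 - s n) ≤ B) (hΔ : ∀ n, |Δ n| ≤ 2 * Real.pi - δ)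
    (hΔ0 : ∀ n, Δ n ≠ 0)
    (hc : Tendsto (fun n : ℕ => ((-Real.log |Δ n| / Real.log n : ℝ) : EReal)) atTop (𝓝 c)) :
    Tendsto (fun n : ℕ => covKernel (m n) (s n * Complex.exp (Δ n * Complex.I)) / Real.log n) atTop
      (𝓝 ((min c 1).toReal : ℂ)) := by
  refine tendsto_covKernel_of_tendsto_log_max hδ hm hs0 hs1 hB hΔ ?_
  refine (tendsto_min_toReal hmlog hc).congr' ?_
  filter_upwards [hm, tendsto_natCast_log_atTop.eventually_gt_atTop 0] with n hmn hn
  have hm0 : (0 : ℝ) < m n := by exact_mod_cast (by omega : 0 < m n)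
  rw [neg_log_max_inv hm0 (hΔ0 n), min_div_div_right hn.le]

lemma tendsto_covKernel_zero {m : ℕ → ℕ} {s : ℕ → ℝ} {B : ℝ}
    (hm : ∀ᶠ n in atTop, 2 ≤ m n)
    (hmlog : Tendsto (fun n : ℕ => Real.log (m n) / Real.log n) atTop (𝓝 1))
    (hs0 : ∀ n, 0 ≤ s n) (hs1 : ∀ n, s n ≤ 1)
    (hB : ∀ᶠ n in atTop, m n * (1 - s n) ≤ B) :
    Tendsto (fun n : ℕ => covKernel (m n) (s n * Complex.exp ((0 : ℝ) * Complex.I)) / Real.log n)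
      atTop (𝓝 1) := by
  have := tendsto_covKernel_of_tendsto_log_max (Δ := fun _ => 0) (c := 1) one_pos hm hs0 hs1 hB
    (fun _ => by rw [abs_zero]; linarith [Real.pi_gt_three]) (hmlog.congr' ?_)
  · simpa using this
  · filter_upwards [hm] with n hmn
    rw [abs_zero, max_eq_left (by positivity), one_div, Real.log_inv, neg_neg]

end CovarianceLimit

section TruncationLevel

/-- The truncation of `n` at which the series of `log Z` is cut off. -/
noncomputable def truncRatio (n : ℕ) : ℝ := Real.log n ^ (1 / 4 : ℝ)

/-- The level at which the series of `log Z` is cut off. -/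
noncomputable def truncLevel (n : ℕ) : ℕ := ⌊(n : ℝ) / truncRatio n⌋₊

lemma tendsto_truncRatio : Tendsto truncRatio atTop atTop :=
  (tendsto_rpow_atTop (by norm_num)).comp tendsto_natCast_log_atTop

lemma truncRatio_le {n : ℕ} (hn : 1 ≤ Real.log n) : truncRatio n ≤ n := by
  calc truncRatio n ≤ Real.log n ^ (1 : ℝ) :=
        Real.rpow_le_rpow_of_exponent_le hn (by norm_num)
    _ = Real.log n := Real.rpow_one _
    _ ≤ n := Real.log_le_self (Nat.cast_nonneg n)

lemma truncLevel_le_div {n : ℕ} (hn : 0 < truncRatio n) :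
    (truncLevel n : ℝ) ≤ n / truncRatio n := Nat.floor_le (by positivity)

lemma div_lt_truncLevel {n : ℕ} (hn : 1 ≤ Real.log n) :
    (n : ℝ) / (2 * truncRatio n) < truncLevel n := by
  have h0 : 0 < truncRatio n := Real.rpow_pos_of_pos (by linarith) _
  have h1 := Nat.div_two_lt_floor ((one_le_div h0).mpr (truncRatio_le hn))
  rw [mul_comm, ← div_div]
  exact h1

lemma sqrt_log_eq_truncRatio_sq {n : ℕ} (hn : 0 ≤ Real.log n) :
    Real.sqrt (Real.log n) = truncRatio n ^ 2 := by
  rw [truncRatio, Real.sqrt_eq_rpow, ← Real.rpow_natCast, ← Real.rpow_mul hn]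
  norm_num

lemma tendsto_log_truncLevel_div :
    Tendsto (fun n : ℕ => Real.log (truncLevel n) / Real.log n) atTop (𝓝 1) := by
  have hL := tendsto_natCast_log_atTop
  have h1 : Tendsto (fun n : ℕ => Real.log (Real.log n) / Real.log n) atTop (𝓝 0) :=
    Real.isLittleO_log_id_atTop.tendsto_div_nhds_zero.comp hL
  have h2 : Tendsto (fun n : ℕ => 1 - (Real.log 2 / Real.log n +
      1 / 4 * (Real.log (Real.log n) / Real.log n))) atTop (𝓝 1) := by
    have := ((hL.const_div_atTop (Real.log 2)).add (h1.const_mul (1 / 4))).const_sub 1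
    rwa [mul_zero, add_zero, sub_zero] at this
  refine tendsto_of_tendsto_of_tendsto_of_le_of_le' h2 tendsto_const_nhds ?_ ?_
  · filter_upwards [hL.eventually_ge_atTop 1] with n hn
    have hn0 : (0 : ℝ) < n := by
      by_contra! h
      have : (n : ℝ) = 0 := le_antisymm h (Nat.cast_nonneg n)
      rw [this, Real.log_zero] at hn
      linarith
    have h0 : 0 < truncRatio n := Real.rpow_pos_of_pos (by linarith) _
    have h3 := Real.log_le_log (by positivity) (div_lt_truncLevel hn).le
    rw [Real.log_div hn0.ne' (by positivity), Real.log_mul two_ne_zero h0.ne', truncRatio,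
      Real.log_rpow (by linarith)] at h3
    rw [le_div_iff₀ (by linarith)]
    have : (1 - (Real.log 2 / Real.log n + 1 / 4 * (Real.log (Real.log n) / Real.log n))) *
        Real.log n = Real.log n - (Real.log 2 + 1 / 4 * Real.log (Real.log n)) := by
      have : Real.log n ≠ 0 := by linarith
      field_simp
    linarith
  · filter_upwards [hL.eventually_ge_atTop 1, tendsto_truncRatio.eventually_ge_atTop 1] with n hn h1
    have hm : 0 < (truncLevel n : ℝ) := lt_of_le_of_lt (by positivity) (div_lt_truncLevel hn)
    have h2 : (truncLevel n : ℝ) ≤ n :=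
      (truncLevel_le_div (by linarith)).trans (div_le_self (Nat.cast_nonneg n) h1)
    exact (div_le_one (by linarith)).mpr (Real.log_le_log hm h2)

lemma truncLevel_le {n : ℕ} (hn : 1 ≤ truncRatio n) : (truncLevel n : ℝ) ≤ n :=
  (truncLevel_le_div (by linarith)).trans (div_le_self (Nat.cast_nonneg n) hn)

lemma eventually_two_le_truncLevel : ∀ᶠ n in atTop, 2 ≤ truncLevel n := by
  have h := (tendsto_log_truncLevel_div.pos_mul_atTop one_pos tendsto_natCast_log_atTop)
  filter_upwards [h.eventually_gt_atTop 0, tendsto_natCast_log_atTop.eventually_gt_atTop 0]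
    with n h1 h2
  rw [div_mul_cancel₀ _ h2.ne'] at h1
  by_contra! h3
  interval_cases hk : truncLevel n <;> simp at h1

lemma tendsto_truncLevel_error :
    Tendsto (fun n : ℕ => (Real.sqrt (Real.log n))⁻¹ * (4 * n / truncLevel n)) atTop (𝓝 0) := by
  refine squeeze_zero' ?_ ?_ (tendsto_truncRatio.const_div_atTop 8)
  · exact Eventually.of_forall fun n => by positivity
  · filter_upwards [tendsto_natCast_log_atTop.eventually_ge_atTop 1,
      tendsto_truncRatio.eventually_ge_atTop 1] with n hn h1
    have h0 : 0 < truncRatio n := by linarith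
    have hlt := div_lt_truncLevel hn
    have hm : 0 < (truncLevel n : ℝ) := lt_of_le_of_lt (by positivity) hlt
    rw [sqrt_log_eq_truncRatio_sq (by linarith)]
    rw [div_lt_iff₀ (by positivity)] at hlt
    have h2 : 4 * (n : ℝ) / truncLevel n ≤ 8 * truncRatio n := by
      rw [div_le_iff₀ hm]
      linarith
    calc _ ≤ (truncRatio n ^ 2)⁻¹ * (8 * truncRatio n) :=
          mul_le_mul_of_nonneg_left h2 (by positivity)
      _ = _ := by field_simp

lemma two_mul_floor_mul_truncLevel_le {n : ℕ} (hn : 0 < truncRatio n) :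
    2 * ⌊truncRatio n / 2⌋₊ * truncLevel n ≤ n := by
  have h1 : (⌊truncRatio n / 2⌋₊ : ℝ) ≤ truncRatio n / 2 := Nat.floor_le (by positivity)
  have h2 := truncLevel_le_div hn
  have h3 : (2 * ⌊truncRatio n / 2⌋₊ * truncLevel n : ℝ) ≤ n := by
    calc (2 * ⌊truncRatio n / 2⌋₊ * truncLevel n : ℝ) ≤
          2 * (truncRatio n / 2) * (n / truncRatio n) := by gcongr
      _ = n := by field_simp
  exact_mod_cast h3

end TruncationLevel

section CharFun

lemma norm_cexp_I_mul_re_sub_le (z w : ℂ) :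
    ‖Complex.exp (Complex.I * z.re) - Complex.exp (Complex.I * w.re)‖ ≤ ‖z - w‖ := by
  have h1 : Complex.exp (Complex.I * z.re) - Complex.exp (Complex.I * w.re) =
      Complex.exp (Complex.I * w.re) * (Complex.exp (Complex.I * (z.re - w.re : ℝ)) - 1) := by
    rw [mul_sub, ← Complex.exp_add, mul_one]
    congr 2
    push_cast
    ring
  rw [h1, norm_mul, Complex.norm_exp_I_mul_ofReal, one_mul]
  refine Real.norm_exp_I_mul_ofReal_sub_one_le.trans ?_
  rw [Real.norm_eq_abs, ← Complex.sub_re]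
  exact Complex.abs_re_le_norm _

lemma linStat_sum {ι : Type*} [Fintype ι] {n : ℕ} (m : ℕ) (ν : ι → ℂ) (a : ι → ℕ → ℂ)
    (u : UnitaryMat n) :
    linStat m (fun j => ∑ k, ν k * a k j) u = ∑ k, ν k * linStat m (a k) u := by
  simp only [linStat, Finset.mul_sum, Finset.sum_mul]
  rw [Finset.sum_comm]
  exact Finset.sum_congr rfl fun k _ => Finset.sum_congr rfl fun j _ => mul_assoc _ _ _

lemma linVar_truncCoeff {ι : Type*} [Fintype ι] (m : ℕ) (ν x : ι → ℂ) :
    linVar m (fun j => ∑ k, ν k * truncCoeff m (x k) j) =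
      (∑ i, ∑ k, conj (ν i) * ν k * covKernel m (conj (x i) * x k)).re := by
  have h1 : ((linVar m (fun j => ∑ k, ν k * truncCoeff m (x k) j) : ℝ) : ℂ) =
      ∑ i, ∑ k, conj (ν i) * ν k * covKernel m (conj (x i) * x k) := by
    simp only [linVar, covKernel, Finset.mul_sum]
    push_cast
    rw [Finset.sum_congr rfl fun i (_ : i ∈ Finset.univ) => Finset.sum_comm, Finset.sum_comm]
    refine Finset.sum_congr rfl fun j _ => ?_
    rw [← Complex.conj_mul', map_sum, Finset.sum_mul_sum, Finset.mul_sum]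
    refine Finset.sum_congr rfl fun i _ => ?_
    rw [Finset.mul_sum]
    refine Finset.sum_congr rfl fun k _ => ?_
    simp only [truncCoeff, covWeight, map_mul, map_pow, Complex.conj_ofReal]
    push_cast
    ring
  rw [← h1, Complex.ofReal_re]

variable {n : ℕ} (μ : Measure (UnitaryMat n)) [IsProbabilityMeasure μ] [μ.IsMulLeftInvariant]

lemma norm_integral_cexp_logZ_sub_le {ι : Type*} [Fintype ι] {m : ℕ} (hm : 1 ≤ m) {ε : ℝ}
    (hε : 0 ≤ ε) (φ : ι → ℝ) (ν : ι → ℂ) :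
    ‖∫ u, Complex.exp (Complex.I * (∑ k, ν k * logZ n u ε (φ k)).re) ∂μ -
      ∫ u, Complex.exp (Complex.I *
        (linStat m (fun j => ∑ k, -ν k * truncCoeff m (seriesPoint ε (φ k)) j) u).re) ∂μ‖ ≤
      ∑ k, ‖ν k‖ * (4 * n / m) := by
  have hZ : AEMeasurable (fun u => ∑ k, ν k * logZ n u ε (φ k)) μ :=
    Finset.aemeasurable_fun_sum _ fun k _ => (aemeasurable_logZ μ hε (φ k)).const_mul _
  have hint : Integrable (fun u => Complex.exp (Complex.I * (∑ k, ν k * logZ n u ε (φ k)).re)) μ := by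
    refine Integrable.of_bound (C := 1) ?_ (Eventually.of_forall fun u => ?_)
    · exact (Complex.measurable_exp.comp_aemeasurable
        ((Complex.measurable_ofReal.comp_aemeasurable
          (Complex.measurable_re.comp_aemeasurable hZ)).const_mul _)).aestronglyMeasurable
    · rw [Complex.norm_exp_I_mul_ofReal]
  set a : ℕ → ℂ := fun j => ∑ k, -ν k * truncCoeff m (seriesPoint ε (φ k)) j with ha
  have hint' : Integrable (fun u => Complex.exp (Complex.I * (linStat m a u).re)) μ := by
    refine integrable_of_continuous ?_
    have := continuous_linStat (n := n) m a
    fun_prop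
  rw [← integral_sub hint hint', ← ENNReal.ofReal_le_ofReal_iff (by positivity), ofReal_norm]
  refine (enorm_integral_le_lintegral_enorm _).trans ?_
  have hpt : ∀ u, ‖Complex.exp (Complex.I * (∑ k, ν k * logZ n u ε (φ k)).re) -
      Complex.exp (Complex.I * (linStat m a u).re)‖ₑ ≤ ∑ k, ‖ν k‖ₑ *
        ‖logZ n u ε (φ k) + linStat m (truncCoeff m (seriesPoint ε (φ k))) u‖ₑ := fun u => by
    refine (enorm_le_iff_norm_le.mpr (norm_cexp_I_mul_re_sub_le _ _)).trans ?_
    have e1 : ∑ k, ν k * logZ n u ε (φ k) - linStat m a u = ∑ k, ν k *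
        (logZ n u ε (φ k) + linStat m (truncCoeff m (seriesPoint ε (φ k))) u) := by
      rw [ha, linStat_sum, ← Finset.sum_sub_distrib]
      exact Finset.sum_congr rfl fun k _ => by ring
    rw [e1]
    refine (enorm_sum_le _ _).trans (le_of_eq ?_)
    exact Finset.sum_congr rfl fun k _ => enorm_mul _ _
  refine (lintegral_mono hpt).trans ?_
  have hmeas : ∀ k, AEMeasurable (fun u =>
      ‖logZ n u ε (φ k) + linStat m (truncCoeff m (seriesPoint ε (φ k))) u‖ₑ) μ := fun k =>
    ((aemeasurable_logZ μ hε (φ k)).add (continuous_linStat m _).measurable.aemeasurable).enorm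
  rw [lintegral_finsetSum' _ fun k _ => (hmeas k).const_mul _,
    ENNReal.ofReal_sum_of_nonneg fun k _ => by positivity]
  refine Finset.sum_le_sum fun k _ => ?_
  rw [lintegral_const_mul'' _ (hmeas k), ENNReal.ofReal_mul (norm_nonneg _), ofReal_norm]
  exact mul_le_mul_right (lintegral_logZ_add_linStat_le μ hm hε (φ k)) _

end CharFun

section CharFunLimit

variable {ℓ : ℕ}

lemma conj_seriesPoint_mul (ε φ ψ : ℝ) : conj (seriesPoint ε φ) * seriesPoint ε ψ =
    (Real.exp (-2 * ε) : ℝ) * Complex.exp ((φ - ψ : ℝ) * Complex.I) := by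
  rw [seriesPoint, seriesPoint, ← Complex.exp_conj, ← Complex.exp_add, Complex.ofReal_exp,
    ← Complex.exp_add]
  congr 1
  simp
  ring

lemma tendsto_pow_div_factorial_of_tendsto {s : ℕ → ℝ} {v : ℝ} (hs0 : ∀ n, 0 ≤ s n)
    (hs : Tendsto s atTop (𝓝 v)) {A : ℕ → ℕ} (hA : Tendsto A atTop atTop) :
    Tendsto (fun n => s n ^ A n / (A n).factorial) atTop (𝓝 0) := by
  have h1 := (FloorSemiring.tendsto_pow_div_factorial_atTop (v + 1)).comp hA
  refine squeeze_zero' (Eventually.of_forall fun n => ?_) ?_ h1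
  · have := hs0 n
    positivity
  · filter_upwards [hs.eventually_le_const (lt_add_one v)] with n hn
    have := hs0 n
    simp only [Function.comp_apply]
    gcongr

variable (μ : ∀ n : ℕ, Measure (UnitaryMat n)) [∀ n, IsProbabilityMeasure (μ n)]
  [∀ n, (μ n).IsMulLeftInvariant]

lemma tendsto_integral_cexp_logZ {ε : ℕ → ℝ} (hε : ∀ n, 0 ≤ ε n) {B : ℝ}
    (hB : ∀ n : ℕ, (n : ℝ) * ε n ≤ B) {φ : Fin ℓ → ℕ → ℝ} {δ : ℝ} (hδ : 0 < δ)
    (hφ0 : ∀ n i, 0 ≤ φ i n) (hφinj : ∀ n i j, i ≠ j → φ i n ≠ φ j n)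
    (hφub : ∀ n i, φ i n < 2 * Real.pi - δ) {c : Fin ℓ → Fin ℓ → ℝ≥0∞}
    (hc : ∀ i j, i ≠ j →
      Tendsto (fun n => ((-Real.log |φ j n - φ i n| / Real.log n : ℝ) : EReal))
        atTop (𝓝 (c i j))) (ν : Fin ℓ → ℂ) :
    0 ≤ (∑ i, ∑ j, conj (ν i) *
      (if i = j then 1 else ((min (c i j) 1).toReal : ℂ)) * ν j).re ∧
    Tendsto (fun n => ∫ u, Complex.exp (Complex.I *
        (∑ k, ν k * ((Real.sqrt (Real.log n) : ℂ)⁻¹ * logZ n u (ε n) (φ k n))).re) ∂(μ n)) atTop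
      (𝓝 (Real.exp (-((∑ i, ∑ j, conj (ν i) *
        (if i = j then 1 else ((min (c i j) 1).toReal : ℂ)) * ν j).re / 4)) : ℝ)) := by
  set v := (∑ i, ∑ j, conj (ν i) *
      (if i = j then 1 else ((min (c i j) 1).toReal : ℂ)) * ν j).re with hv
  set η : ℕ → Fin ℓ → ℂ := fun n k => (Real.sqrt (Real.log n) : ℂ)⁻¹ * ν k with hη
  set a : ℕ → ℕ → ℂ := fun n j =>
    ∑ k, -η n k * truncCoeff (truncLevel n) (seriesPoint (ε n) (φ k n)) j with ha
  set s : ℕ → ℝ := fun n => linVar (truncLevel n) (a n) / 4 with hs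
  have hs0 : ∀ n, 0 ≤ s n := fun n => div_nonneg (linVar_nonneg _ _) (by norm_num)
  have hK : ∀ i k, Tendsto (fun n : ℕ => covKernel (truncLevel n)
      (conj (seriesPoint (ε n) (φ i n)) * seriesPoint (ε n) (φ k n)) / Real.log n) atTop
      (𝓝 (if i = k then 1 else ((min (c i k) 1).toReal : ℂ))) := by
    intro i k
    simp only [conj_seriesPoint_mul]
    have hs1 : ∀ n, Real.exp (-2 * ε n) ≤ 1 := fun n =>
      Real.exp_le_one_iff.mpr (by linarith [hε n])
    have hBs : ∀ᶠ n : ℕ in atTop, truncLevel n * (1 - Real.exp (-2 * ε n)) ≤ 2 * B := by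
      filter_upwards [tendsto_truncRatio.eventually_ge_atTop 1] with n hn
      have h1 := Real.add_one_le_exp (-2 * ε n)
      calc (truncLevel n : ℝ) * (1 - Real.exp (-2 * ε n)) ≤ n * (2 * ε n) := by
            refine mul_le_mul (truncLevel_le hn) (by linarith) ?_ (Nat.cast_nonneg n)
            linarith [hs1 n]
        _ ≤ 2 * B := by linarith [hB n]
    split_ifs with hik
    · subst hik
      simp only [sub_self]
      exact tendsto_covKernel_zero eventually_two_le_truncLevel tendsto_log_truncLevel_div
        (fun n => (Real.exp_pos _).le) hs1 hBs
    · refine tendsto_covKernel hδ eventually_two_le_truncLevel tendsto_log_truncLevel_div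
        (fun n => (Real.exp_pos _).le) hs1 hBs (fun n => ?_) (fun n => ?_) ?_
      · rw [abs_le]
        constructor <;> linarith [hφ0 n i, hφ0 n k, hφub n i, hφub n k]
      · exact sub_ne_zero.mpr (hφinj n i k hik)
      · refine (hc i k hik).congr fun n => ?_
        rw [abs_sub_comm]
  have hlin : Tendsto s atTop (𝓝 (v / 4)) := by
    have h1 : Tendsto (fun n : ℕ => (∑ i, ∑ k, conj (ν i) * (covKernel (truncLevel n)
        (conj (seriesPoint (ε n) (φ i n)) * seriesPoint (ε n) (φ k n)) / Real.log n) * ν k).re)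
        atTop (𝓝 v) :=
      (Complex.continuous_re.tendsto _).comp (tendsto_finsetSum _ fun i _ =>
        tendsto_finsetSum _ fun k _ => ((hK i k).const_mul _).mul_const _)
    refine (h1.div_const 4).congr' ?_
    filter_upwards [tendsto_natCast_log_atTop.eventually_gt_atTop 0] with n hn
    rw [hs, ha]
    simp only [linVar_truncCoeff]
    congr 2
    refine Finset.sum_congr rfl fun i _ => Finset.sum_congr rfl fun k _ => ?_
    have h2 : ((Real.sqrt (Real.log n) : ℝ) : ℂ)⁻¹ * ((Real.sqrt (Real.log n) : ℝ) : ℂ)⁻¹ =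
        ((Real.log n : ℝ) : ℂ)⁻¹ := by
      rw [← mul_inv, ← Complex.ofReal_mul, Real.mul_self_sqrt hn.le]
    rw [hη]
    simp only [map_neg, map_mul, map_inv₀, Complex.conj_ofReal]
    linear_combination (-conj (ν i) * ν k * covKernel (truncLevel n)
        (conj (seriesPoint (ε n) (φ i n)) * seriesPoint (ε n) (φ k n))) * h2
  have hv0 : 0 ≤ v := by
    have := ge_of_tendsto' hlin hs0
    linarith
  refine ⟨hv0, ?_⟩
  have hA : Tendsto (fun n => ⌊truncRatio n / 2⌋₊) atTop atTop :=
    tendsto_nat_floor_atTop.comp (tendsto_truncRatio.atTop_div_const two_pos)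
  have h1 : Tendsto (fun n => ∫ u, Complex.exp (Complex.I * (linStat (truncLevel n) (a n) u).re)
      ∂(μ n) - (Real.exp (-s n) : ℝ)) atTop (𝓝 0) := by
    have h2 := (tendsto_pow_div_factorial_of_tendsto hs0 hlin hA).const_mul 2
    rw [mul_zero] at h2
    refine squeeze_zero_norm' ?_ h2
    filter_upwards [tendsto_truncRatio.eventually_gt_atTop 0] with n hn
    exact norm_charFun_linStat_sub_le (μ n) _ _ _ (two_mul_floor_mul_truncLevel_le hn)
  have h3 : Tendsto (fun n => ∫ u, Complex.exp (Complex.I *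
        (∑ k, η n k * logZ n u (ε n) (φ k n)).re) ∂(μ n) -
      ∫ u, Complex.exp (Complex.I * (linStat (truncLevel n) (a n) u).re) ∂(μ n)) atTop (𝓝 0) := by
    have h4 := tendsto_truncLevel_error.const_mul (∑ k, ‖ν k‖)
    rw [mul_zero] at h4
    refine squeeze_zero_norm' ?_ h4
    filter_upwards [eventually_two_le_truncLevel] with n hn
    refine (norm_integral_cexp_logZ_sub_le (μ n) (by omega) (hε n) _ _).trans (le_of_eq ?_)
    rw [Finset.sum_mul]
    refine Finset.sum_congr rfl fun k _ => ?_
    rw [hη, norm_mul, norm_inv, Complex.norm_real, Real.norm_of_nonneg (Real.sqrt_nonneg _)]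
    ring
  have h5 : Tendsto (fun n => ((Real.exp (-s n) : ℝ) : ℂ)) atTop
      (𝓝 ((Real.exp (-(v / 4)) : ℝ) : ℂ)) :=
    (Complex.continuous_ofReal.tendsto _).comp
      ((Real.continuous_exp.tendsto _).comp hlin.neg)
  have h6 := (h3.add h1).add h5
  rw [add_zero, zero_add] at h6
  refine h6.congr fun n => ?_
  rw [sub_add_sub_cancel, sub_add_cancel]
  refine integral_congr_ae (Eventually.of_forall fun u => ?_)
  simp only [hη]
  congr 4
  refine Finset.sum_congr rfl fun k _ => ?_
  ring

end CharFunLimit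

instance isProbabilityMeasure_stdComplexNormal : IsProbabilityMeasure stdComplexNormal :=
  Measure.isProbabilityMeasure_map (by fun_prop)

instance isProbabilityMeasure_complexNormal (v : ℝ) : IsProbabilityMeasure (complexNormal v) :=
  Measure.isProbabilityMeasure_map (by fun_prop)

theorem integral_cexp_stdComplexNormal (w : ℂ) :
    ∫ z, Complex.exp (Complex.I * ((w * z).re : ℝ)) ∂stdComplexNormal
      = Complex.exp (-(‖w‖ ^ 2 / 4 : ℝ)) := by
  rw [stdComplexNormal, integral_map (by fun_prop) (by fun_prop)]
  have h1 : ∀ p : ℝ × ℝ,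
      Complex.exp (Complex.I * ((w * ((p.1 : ℂ) + p.2 * Complex.I)).re : ℝ))
        = Complex.exp ((w.re : ℂ) * p.1 * Complex.I)
          * Complex.exp (((-w.im : ℝ) : ℂ) * p.2 * Complex.I) := by
    intro p
    rw [← Complex.exp_add]
    congr 1
    simp only [Complex.mul_re, Complex.add_re, Complex.ofReal_re, Complex.add_im,
      Complex.ofReal_im, Complex.mul_im, Complex.I_re, Complex.I_im]
    push_cast
    ring
  simp_rw [h1]
  rw [integral_prod_mul
    (fun x : ℝ => Complex.exp ((w.re : ℂ) * x * Complex.I))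
    (fun x : ℝ => Complex.exp (((-w.im : ℝ) : ℂ) * x * Complex.I)),
    ← charFun_apply_real, ← charFun_apply_real, ProbabilityTheory.charFun_gaussianReal,
    ProbabilityTheory.charFun_gaussianReal, ← Complex.exp_add, ← Complex.normSq_eq_norm_sq,
    Complex.normSq_apply]
  congr 1
  push_cast
  ring

theorem integral_cexp_complexNormal {v : ℝ} (hv : 0 ≤ v) (w : ℂ) :
    ∫ z, Complex.exp (Complex.I * ((w * z).re : ℝ)) ∂complexNormal v
      = Complex.exp (-(v * ‖w‖ ^ 2 / 4 : ℝ)) := by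
  rw [complexNormal, integral_map (by fun_prop) (by fun_prop)]
  simp_rw [← mul_assoc]
  rw [integral_cexp_stdComplexNormal, norm_mul, Complex.norm_real, mul_pow, Real.norm_eq_abs,
    sq_abs, Real.sq_sqrt hv, mul_comm v]

/-- A finite measure on `ℂ` is determined by its characteristic function, written bilinearly. -/
theorem measure_complex_ext {μ ν : Measure ℂ} [IsFiniteMeasure μ] [IsFiniteMeasure ν]
    (h : ∀ w : ℂ, ∫ z, Complex.exp (Complex.I * ((w * z).re : ℝ)) ∂μ
      = ∫ z, Complex.exp (Complex.I * ((w * z).re : ℝ)) ∂ν) : μ = ν := by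
  refine Measure.ext_of_charFun (funext fun t => ?_)
  have key : ∀ z : ℂ, ((inner ℝ z t : ℝ) : ℂ) * Complex.I
      = Complex.I * ((conj t * z).re : ℝ) := by
    intro z
    rw [Complex.inner, mul_comm]
    congr 2
    simp only [Complex.mul_re, Complex.conj_re, Complex.conj_im]
    ring
  simp only [charFun_apply, key]
  exact h _

open scoped ComplexOrder MatrixOrder in
theorem exists_matrix_re_quadratic_eq_sum_norm_sq {ι : Type*} [Fintype ι] (C : ι → ι → ℂ)
    (hC : ∀ ν : ι → ℂ, 0 ≤ (∑ i, ∑ j, conj (ν i) * C i j * ν j).re) :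
    ∃ B : Matrix ι ι ℂ, ∀ ν : ι → ℂ,
      (∑ i, ∑ j, conj (ν i) * C i j * ν j).re = ∑ j, ‖(B.mulVec ν) j‖ ^ 2 := by
  let M : Matrix ι ι ℂ := Matrix.of C
  let H : Matrix ι ι ℂ := (1 / 2 : ℂ) • (M + M.conjTranspose)
  have hq : ∀ ν : ι → ℂ, dotProduct (star ν) (M.mulVec ν)
      = ∑ i, ∑ j, conj (ν i) * C i j * ν j := by
    intro ν
    simp only [dotProduct, Matrix.mulVec, Finset.mul_sum, M, Matrix.of_apply, Pi.star_apply,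
      mul_assoc]
    rfl
  have hH : ∀ ν : ι → ℂ, dotProduct (star ν) (H.mulVec ν)
      = (((∑ i, ∑ j, conj (ν i) * C i j * ν j).re : ℝ) : ℂ) := by
    intro ν
    have h2 : dotProduct (star ν) (M.conjTranspose.mulVec ν)
        = conj (∑ i, ∑ j, conj (ν i) * C i j * ν j) := by
      rw [← hq, starRingEnd_apply, Matrix.star_dotProduct, Matrix.star_mulVec,
        Matrix.dotProduct_mulVec, Matrix.conjTranspose_conjTranspose]
    rw [Matrix.smul_mulVec, Matrix.add_mulVec, dotProduct_smul, dotProduct_add, hq, h2,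
      Complex.add_conj, smul_eq_mul]
    push_cast
    ring
  have hpos : H.PosSemidef := by
    refine Matrix.PosSemidef.of_dotProduct_mulVec_nonneg ?_ fun ν => ?_
    · ext i j
      simp [H, Matrix.conjTranspose_apply, add_comm]
    · rw [hH]
      exact_mod_cast hC ν
  obtain ⟨B, hB⟩ := CStarAlgebra.nonneg_iff_eq_star_mul_self.mp hpos.nonneg
  refine ⟨B, fun ν => ?_⟩
  have h := hH ν
  rw [hB, Matrix.star_eq_conjTranspose, ← Matrix.mulVec_mulVec, Matrix.dotProduct_mulVec, ← Matrix.star_mulVec] at h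
  have h3 : dotProduct (star (B.mulVec ν)) (B.mulVec ν)
      = ((∑ j, ‖(B.mulVec ν) j‖ ^ 2 : ℝ) : ℂ) := by
    simp only [dotProduct, Pi.star_apply]
    push_cast
    refine Finset.sum_congr rfl fun j _ => ?_
    exact Complex.conj_mul' _
  rw [h3] at h
  exact_mod_cast h.symm

/-- Every nonnegative quadratic form is the covariance of a centered complex Gaussian vector. -/
theorem exists_isCenteredComplexGaussianVector {ℓ : ℕ} (C : Fin ℓ → Fin ℓ → ℂ)
    (hC : ∀ ν : Fin ℓ → ℂ, 0 ≤ (∑ i, ∑ j, conj (ν i) * C i j * ν j).re) :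
    ∃ γ : Measure (Fin ℓ → ℂ), IsCenteredComplexGaussianVector γ C ∧
      ∀ ν : Fin ℓ → ℂ, ∫ z, Complex.exp (Complex.I * ((∑ k, ν k * z k).re : ℝ)) ∂γ
        = ((Real.exp (-((∑ i, ∑ j, conj (ν i) * C i j * ν j).re / 4)) : ℝ) : ℂ) := by
  obtain ⟨B, hB⟩ := exists_matrix_re_quadratic_eq_sum_norm_sq C hC
  let T : (Fin ℓ → ℂ) → Fin ℓ → ℂ := fun x k => ∑ j, B j k * x j
  have hT : Measurable T := by
    refine measurable_pi_lambda _ fun k => ?_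
    fun_prop
  let γ : Measure (Fin ℓ → ℂ) := (Measure.pi fun _ => stdComplexNormal).map T
  have hγ : IsProbabilityMeasure γ := Measure.isProbabilityMeasure_map hT.aemeasurable
  have hchar : ∀ ν : Fin ℓ → ℂ, ∫ z, Complex.exp (Complex.I * ((∑ k, ν k * z k).re : ℝ)) ∂γ
        = ((Real.exp (-((∑ i, ∑ j, conj (ν i) * C i j * ν j).re / 4)) : ℝ) : ℂ) := by
    intro ν
    have hsum : ∀ x : Fin ℓ → ℂ, ∑ k, ν k * T x k = ∑ j, (B.mulVec ν) j * x j := by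
      intro x
      simp only [T, Matrix.mulVec, dotProduct, Finset.mul_sum, Finset.sum_mul]
      rw [Finset.sum_comm]
      refine Finset.sum_congr rfl fun j _ => Finset.sum_congr rfl fun k _ => ?_
      ring
    have hprod : ∀ x : Fin ℓ → ℂ,
        Complex.exp (Complex.I * ((∑ j, (B.mulVec ν) j * x j).re : ℝ))
          = ∏ j, Complex.exp (Complex.I * (((B.mulVec ν) j * x j).re : ℝ)) := by
      intro x
      rw [← Complex.exp_sum, Complex.re_sum, Complex.ofReal_sum, Finset.mul_sum]
    have hf : Measurable fun z : Fin ℓ → ℂ =>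
        Complex.exp (Complex.I * ((∑ k, ν k * z k).re : ℝ)) := by fun_prop
    rw [integral_map hT.aemeasurable hf.aestronglyMeasurable]
    simp_rw [hsum, hprod]
    rw [integral_fintype_prod_eq_prod
      (fun j (z : ℂ) => Complex.exp (Complex.I * (((B.mulVec ν) j * z).re : ℝ)))]
    simp_rw [integral_cexp_stdComplexNormal]
    rw [← Complex.exp_sum, Complex.ofReal_exp, hB ν, Finset.sum_div, Complex.ofReal_neg,
      Complex.ofReal_sum, Finset.sum_neg_distrib]
  refine ⟨γ, ⟨hγ, fun ν => ?_⟩, hchar⟩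
  have hm : Measurable fun z : Fin ℓ → ℂ => ∑ i, ν i * z i := by fun_prop
  have : IsProbabilityMeasure (γ.map fun z => ∑ i, ν i * z i) :=
    Measure.isProbabilityMeasure_map hm.aemeasurable
  refine measure_complex_ext fun w => ?_
  rw [integral_cexp_complexNormal (hC ν), integral_map hm.aemeasurable (by fun_prop)]
  simp_rw [Finset.mul_sum, ← mul_assoc]
  rw [hchar fun k => w * ν k, Complex.ofReal_exp, hB, hB]
  congr 1
  have h5 : B.mulVec (fun k => w * ν k) = w • B.mulVec ν := by
    rw [← Matrix.mulVec_smul]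
    rfl
  rw [h5]
  simp only [Pi.smul_apply, smul_eq_mul, norm_mul, mul_pow]
  rw [← Finset.mul_sum]
  push_cast
  ring

/-- Lévy's continuity theorem for random vectors in `ℂ^ℓ`. -/
theorem tendsto_integral_of_tendsto_integral_cexp {ℓ : ℕ} {Ω : ℕ → Type*}
    [∀ n, MeasurableSpace (Ω n)] (μ : ∀ n, Measure (Ω n)) [∀ n, IsProbabilityMeasure (μ n)]
    {X : ∀ n, Ω n → Fin ℓ → ℂ} (hX : ∀ n, AEMeasurable (X n) (μ n))
    (γ : Measure (Fin ℓ → ℂ)) [IsProbabilityMeasure γ]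
    (h : ∀ ν : Fin ℓ → ℂ, Tendsto
      (fun n => ∫ u, Complex.exp (Complex.I * ((∑ k, ν k * X n u k).re : ℝ)) ∂(μ n)) atTop
      (𝓝 (∫ z, Complex.exp (Complex.I * ((∑ k, ν k * z k).re : ℝ)) ∂γ)))
    (g : BoundedContinuousFunction (Fin ℓ → ℂ) ℝ) :
    Tendsto (fun n => ∫ u, g (X n u) ∂(μ n)) atTop (𝓝 (∫ z, g z ∂γ)) := by
  let e : (Fin ℓ → ℂ) → PiLp 2 (fun _ : Fin ℓ => ℂ) := WithLp.toLp 2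
  have hec : Continuous e := PiLp.continuous_toLp 2 _
  have he : Measurable e := hec.measurable
  have heX : ∀ n, AEMeasurable (fun u => e (X n u)) (μ n) := fun n =>
    he.comp_aemeasurable (hX n)
  have : ∀ n, IsProbabilityMeasure ((μ n).map fun u => e (X n u)) := fun n =>
    Measure.isProbabilityMeasure_map (heX n)
  have : IsProbabilityMeasure (γ.map e) := Measure.isProbabilityMeasure_map he.aemeasurable
  let P : ℕ → ProbabilityMeasure (PiLp 2 (fun _ : Fin ℓ => ℂ)) := fun n =>
    ⟨(μ n).map fun u => e (X n u), inferInstance⟩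
  let P₀ : ProbabilityMeasure (PiLp 2 (fun _ : Fin ℓ => ℂ)) := ⟨γ.map e, inferInstance⟩
  have hinner : ∀ (x : Fin ℓ → ℂ) (t : PiLp 2 (fun _ : Fin ℓ => ℂ)),
      ((inner ℝ (e x) t : ℝ) : ℂ) * Complex.I
        = Complex.I * ((∑ k, conj (t k) * x k).re : ℝ) := by
    intro x t
    rw [PiLp.inner_apply, Complex.re_sum, mul_comm]
    congr 2
    refine Finset.sum_congr rfl fun k _ => ?_
    rw [Complex.inner]
    simp only [e, Complex.mul_re, Complex.conj_re, Complex.conj_im]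
    ring
  have hlim : Tendsto P atTop (𝓝 P₀) := by
    refine ProbabilityMeasure.tendsto_of_tendsto_charFun fun t => ?_
    have h1 : ∀ n, charFun (P n : Measure (PiLp 2 (fun _ : Fin ℓ => ℂ))) t
        = ∫ u, Complex.exp (Complex.I * ((∑ k, conj (t k) * X n u k).re : ℝ)) ∂(μ n) := by
      intro n
      rw [charFun_apply]
      change ∫ x, _ ∂((μ n).map fun u => e (X n u)) = _
      rw [integral_map (heX n) (by fun_prop)]
      simp only [hinner]
    have h2 : charFun (P₀ : Measure (PiLp 2 (fun _ : Fin ℓ => ℂ))) t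
        = ∫ z, Complex.exp (Complex.I * ((∑ k, conj (t k) * z k).re : ℝ)) ∂γ := by
      rw [charFun_apply]
      change ∫ x, _ ∂(γ.map e) = _
      rw [integral_map he.aemeasurable (by fun_prop)]
      simp only [hinner]
    simp only [h1, h2]
    exact h _
  let g' : BoundedContinuousFunction (PiLp 2 (fun _ : Fin ℓ => ℂ)) ℝ :=
    g.compContinuous ⟨WithLp.ofLp, PiLp.continuous_ofLp 2 _⟩
  have h3 := ProbabilityMeasure.tendsto_iff_forall_integral_tendsto.mp hlim g'
  have h4 : ∀ n, ∫ x, g' x ∂(P n : Measure (PiLp 2 (fun _ : Fin ℓ => ℂ)))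
      = ∫ u, g (X n u) ∂(μ n) := fun n =>
    integral_map (heX n) g'.continuous.aestronglyMeasurable
  have h5 : ∫ x, g' x ∂(P₀ : Measure (PiLp 2 (fun _ : Fin ℓ => ℂ))) = ∫ z, g z ∂γ :=
    integral_map he.aemeasurable g'.continuous.aestronglyMeasurable
  simpa only [h4, h5] using h3

/-- Multidimensional CLT for `log Z` on the unitary group, case `ε_n ≪ 1/n`. -/
theorem multidim_clt_unitary_eps_small
    (ℓ : ℕ) (hℓ : 1 ≤ ℓ)
    (μ : ∀ n : ℕ, Measure (Matrix.unitaryGroup (Fin n) ℂ))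
    (hμprob : ∀ n, IsProbabilityMeasure (μ n))
    (hμinv : ∀ n, ∀ g : Matrix.unitaryGroup (Fin n) ℂ, (μ n).map (fun u => g * u) = μ n)
    (ε : ℕ → ℝ) (hεnonneg : ∀ n, 0 ≤ ε n)
    (B : ℝ) (hεub : ∀ n : ℕ, (n : ℝ) * ε n ≤ B)
    (φ : Fin ℓ → ℕ → ℝ) (δ₀ : ℝ) (hδ₀ : 0 < δ₀)
    (hφ0 : ∀ n i, 0 ≤ φ i n)
    (hφmono : ∀ n, StrictMono fun i => φ i n)
    (hφub : ∀ n i, φ i n < 2 * Real.pi - δ₀)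
    (c : Fin ℓ → Fin ℓ → ℝ≥0∞)
    (hc : ∀ i j, i ≠ j →
      Tendsto (fun n => ((-Real.log |φ j n - φ i n| / Real.log n : ℝ) : EReal))
        atTop (𝓝 (c i j))) :
    ∃ γ : Measure (Fin ℓ → ℂ),
      IsCenteredComplexGaussianVector γ
        (fun i j => if i = j then 1 else ((min (c i j) 1).toReal : ℂ)) ∧
      ∀ g : BoundedContinuousFunction (Fin ℓ → ℂ) ℝ,
        Tendsto (fun n => ∫ u,
            g (fun k => (Real.sqrt (Real.log n) : ℂ)⁻¹ * logZ n u (ε n) (φ k n)) ∂(μ n))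
          atTop (𝓝 (∫ z, g z ∂γ)) := by
  have hP : ∀ n, IsProbabilityMeasure (μ n) := hμprob
  have hI : ∀ n, (μ n).IsMulLeftInvariant := fun n => ⟨hμinv n⟩
  have key := tendsto_integral_cexp_logZ μ hεnonneg hεub hδ₀ hφ0
    (fun n _ _ hij h => hij ((hφmono n).injective h)) hφub hc
  obtain ⟨γ, hγ, hchar⟩ := exists_isCenteredComplexGaussianVector
    (fun i j => if i = j then 1 else ((min (c i j) 1).toReal : ℂ)) fun ν => (key ν).1
  have := hγ.1
  refine ⟨γ, hγ, fun g => tendsto_integral_of_tendsto_integral_cexp μ (fun n => ?_) γ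
    (fun ν => ?_) g⟩
  · exact aemeasurable_pi_lambda _ fun k =>
      (aemeasurable_logZ (μ n) (hεnonneg n) (φ k n)).const_mul _
  · rw [hchar]
    exact (key ν).2
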